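/- Let n ≥ 1, r > 0, R > 0, and let E ⊆ ℝⁿ be a measurable set with |E| = |B_R|. If Per_r(E) = Per_r(B_R), then there exists x ∈ ℝⁿ such that |E Δ B_R(x)| = 0, i.e. E coincides with a ball of radius R up to a Lebesgue null set. -/

import Mathlib

open MeasureTheory Metric Set Filter Bornology
open scoped ENNReal NNReal Pointwise

noncomputable section

/-- The set of points of Lebesgue density one of `E ⊆ ℝⁿ`. -/
def densityOnePoints (n : ℕ) (E : Set (EuclideanSpace ℝ (Fin n))) :
    Set (EuclideanSpace ℝ (Fin n)) :=
  {x | Tendsto (fun ρ : ℝ => volume (E ∩ ball x ρ) / volume (ball x ρ))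
        (nhdsWithin 0 (Ioi 0)) (nhds 1)}

/-- Minkowski sum `A ⊕ B_r = ⋃_{x ∈ A} B_r(x)`. -/
def minkSum (n : ℕ) (r : ℝ) (A : Set (EuclideanSpace ℝ (Fin n))) :
    Set (EuclideanSpace ℝ (Fin n)) :=
  ⋃ x ∈ A, ball x r

/-- The nonlocal Minkowski perimeter `Per_r(E) = (1/(2r)) |(∂E) ⊕ B_r|`, where `∂E`
is the topological boundary of the density-one representative of `E`. -/
def perR (n : ℕ) (r : ℝ) (E : Set (EuclideanSpace ℝ (Fin n))) : ℝ≥0∞ :=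
  volume (minkSum n r (frontier (densityOnePoints n E))) / ENNReal.ofReal (2 * r)

/-- The inner set `E ⊖ B_r = E \ ((∂E) ⊕ B_r)` (for the density-one representative). -/
def minkSub (n : ℕ) (r : ℝ) (E : Set (EuclideanSpace ℝ (Fin n))) :
    Set (EuclideanSpace ℝ (Fin n)) :=
  densityOnePoints n E \ minkSum n r (frontier (densityOnePoints n E))

/-- The Riesz energy `Φ_α(E) = ∫_E ∫_E |x-y|^{-α} dx dy`. -/
def rieszEnergy (n : ℕ) (α : ℝ) (E : Set (EuclideanSpace ℝ (Fin n))) : ℝ≥0∞ :=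
  ∫⁻ x in E, ∫⁻ y in E, edist x y ^ (-α)

/-- The radius of the ball in `ℝⁿ` with unit volume. -/
def unitRadius (n : ℕ) : ℝ :=
  (volume (ball (0 : EuclideanSpace ℝ (Fin n)) 1)).toReal ^ (-(n : ℝ)⁻¹)

/-- A rigid motion of `ℝⁿ`: a rotation followed by a translation. -/
def IsRigidMotion (n : ℕ) (g : EuclideanSpace ℝ (Fin n) → EuclideanSpace ℝ (Fin n)) : Prop :=
  ∃ (R : EuclideanSpace ℝ (Fin n) ≃ₗᵢ[ℝ] EuclideanSpace ℝ (Fin n))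
    (v : EuclideanSpace ℝ (Fin n)),
    LinearMap.det (R.toLinearEquiv : EuclideanSpace ℝ (Fin n) →ₗ[ℝ] EuclideanSpace ℝ (Fin n)) = 1 ∧
    ∀ x, g x = R x + v


/-- One-dimensional Brunn-Minkowski for compact sets. -/
lemma bm_line {X Y : Set ℝ} (hX : IsCompact X) (hY : IsCompact Y) (hXn : X.Nonempty)
    (hYn : Y.Nonempty) : volume X + volume Y ≤ volume (X + Y) := by
  have hx := hX.sSup_mem hXn
  have hy := hY.sInf_mem hYn
  set x := sSup X with hxd
  set y := sInf Y with hyd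
  have h1 : volume X = volume ((fun z => y + z) '' X) := by
    rw [Set.image_add_left, measure_preimage_add]
  have h2 : volume Y = volume ((fun z => x + z) '' Y) := by
    rw [Set.image_add_left, measure_preimage_add]
  rw [h1, h2, ← measure_union₀]
  · apply measure_mono
    rintro _ (⟨a, ha, rfl⟩ | ⟨b, hb, rfl⟩)
    · exact ⟨a, ha, y, hy, add_comm _ _⟩
    · exact ⟨x, hx, b, hb, rfl⟩
  · exact (hY.image (by fun_prop)).measurableSet.nullMeasurableSet
  · refine measure_mono_null (t := {x + y}) ?_ (by simp)
    rintro _ ⟨⟨a, ha, rfl⟩, ⟨b, hb, hab⟩⟩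
    have h3 : a ≤ x := le_csSup hX.bddAbove ha
    have h4 : y ≤ b := csInf_le hY.bddBelow hb
    simp only at hab ⊢
    simp only [mem_singleton_iff]
    linarith

section slices
variable {m : ℕ}

/-- measure of the vertical slices -/
def gs (A : Set (ℝ × EuclideanSpace ℝ (Fin m))) (s : ℝ) : ℝ := volume.real (Prod.mk s ⁻¹' A)

lemma slice_compact {A : Set (ℝ × EuclideanSpace ℝ (Fin m))} (hA : IsCompact A) (s : ℝ) :
    IsCompact (Prod.mk s ⁻¹' A) := by
  refine (hA.image continuous_snd).of_isClosed_subset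
    (hA.isClosed.preimage (by fun_prop)) ?_
  intro y hy
  exact ⟨(s, y), hy, rfl⟩

lemma gs_nonneg (A : Set (ℝ × EuclideanSpace ℝ (Fin m))) (s : ℝ) : 0 ≤ gs A s :=
  measureReal_nonneg

lemma ofReal_gs {A : Set (ℝ × EuclideanSpace ℝ (Fin m))} (hA : IsCompact A) (s : ℝ) :
    ENNReal.ofReal (gs A s) = volume (Prod.mk s ⁻¹' A) := by
  rw [gs, ofReal_measureReal (slice_compact hA s).measure_lt_top.ne]

lemma gs_mono {A B : Set (ℝ × EuclideanSpace ℝ (Fin m))} (hB : IsCompact B) (h : A ⊆ B) (s : ℝ) :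
    gs A s ≤ gs B s :=
  measureReal_mono (preimage_mono h) (slice_compact hB s).measure_lt_top.ne

lemma gs_pos_nonempty {A : Set (ℝ × EuclideanSpace ℝ (Fin m))} {s : ℝ} (h : 0 < gs A s) :
    (Prod.mk s ⁻¹' A).Nonempty := by
  by_contra hne
  rw [not_nonempty_iff_eq_empty] at hne
  simp [gs, hne] at h

lemma gs_usc {A : Set (ℝ × EuclideanSpace ℝ (Fin m))} (hA : IsCompact A) :
    UpperSemicontinuous (gs A) := by
  intro s c hc
  have hc' : volume (Prod.mk s ⁻¹' A) < ENNReal.ofReal c := by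
    rw [← ofReal_gs hA]
    exact (ENNReal.ofReal_lt_ofReal_iff_of_nonneg (gs_nonneg A s)).2 hc
  obtain ⟨O, hO, hOo, hOc⟩ := Set.exists_isOpen_lt_of_lt _ _ hc'
  have hK : IsCompact (A ∩ (univ ×ˢ Oᶜ)) := by
    apply hA.inter_right
    exact isClosed_univ.prod hOo.isClosed_compl
  have hcl : IsClosed (Prod.fst '' (A ∩ (univ ×ˢ Oᶜ))) :=
    (hK.image continuous_fst).isClosed
  have hs : s ∈ (Prod.fst '' (A ∩ (univ ×ˢ Oᶜ)))ᶜ := by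
    rintro ⟨⟨s', y⟩, ⟨h1, h2⟩, rfl⟩
    exact h2.2 (hO h1)
  filter_upwards [hcl.isOpen_compl.mem_nhds hs] with s' hs'
  have : volume (Prod.mk s' ⁻¹' A) < ENNReal.ofReal c := by
    refine lt_of_le_of_lt (measure_mono ?_) hOc
    intro y hy
    by_contra hyO
    exact hs' ⟨(s', y), ⟨hy, ⟨mem_univ _, hyO⟩⟩, rfl⟩
  rw [← ofReal_gs hA, ENNReal.ofReal_lt_ofReal_iff_of_nonneg (gs_nonneg A s')] at this
  exact this

lemma gs_measurable {A : Set (ℝ × EuclideanSpace ℝ (Fin m))} (hA : IsCompact A) :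
    Measurable (gs A) := (gs_usc hA).measurable

lemma vol_eq_lintegral {A : Set (ℝ × EuclideanSpace ℝ (Fin m))} (hA : IsCompact A) :
    volume A = ∫⁻ s, ENNReal.ofReal (gs A s) := by
  rw [Measure.volume_eq_prod, Measure.prod_apply hA.measurableSet]
  simp_rw [ofReal_gs hA]

lemma gs_integrable {A : Set (ℝ × EuclideanSpace ℝ (Fin m))} (hA : IsCompact A) :
    Integrable (gs A) := by
  refine ⟨(gs_measurable hA).aestronglyMeasurable, ?_⟩
  rw [hasFiniteIntegral_iff_ofReal (Eventually.of_forall (gs_nonneg A)), ← vol_eq_lintegral hA]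
  exact hA.measure_lt_top

lemma vol_eq_integral {A : Set (ℝ × EuclideanSpace ℝ (Fin m))} (hA : IsCompact A) :
    volume.real A = ∫ s, gs A s := by
  rw [integral_eq_lintegral_of_nonneg_ae (Eventually.of_forall (gs_nonneg A))
    (gs_measurable hA).aestronglyMeasurable, ← vol_eq_lintegral hA, measureReal_def]

lemma gs_level_compact {A : Set (ℝ × EuclideanSpace ℝ (Fin m))} (hA : IsCompact A) {c : ℝ}
    (hc : 0 < c) : IsCompact {s | c ≤ gs A s} := by
  refine (hA.image continuous_fst).of_isClosed_subset ?_ ?_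
  · exact (upperSemicontinuous_iff_isClosed_preimage.1 (gs_usc hA)) c
  · intro s hs
    obtain ⟨y, hy⟩ := gs_pos_nonempty (lt_of_lt_of_le hc hs)
    exact ⟨(s, y), hy, rfl⟩

/-- the slice function has a maximum -/
lemma gs_exists_max {A : Set (ℝ × EuclideanSpace ℝ (Fin m))} (hA : IsCompact A)
    (hpos : 0 < volume.real A) : ∃ s, 0 < gs A s ∧ ∀ s', gs A s' ≤ gs A s := by
  have h1 : ∃ s, 0 < gs A s := by
    by_contra! h
    have : ∀ s, gs A s = 0 := fun s => le_antisymm (h s) (gs_nonneg A s)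
    rw [vol_eq_integral hA] at hpos
    simp [this] at hpos
  obtain ⟨s0, hs0⟩ := h1
  obtain ⟨s, hs, hmax⟩ := ((gs_usc hA).upperSemicontinuousOn {s | gs A s0 ≤ gs A s}).exists_isMaxOn
    ⟨s0, le_refl (gs A s0)⟩ (gs_level_compact hA hs0)
  refine ⟨s, lt_of_lt_of_le hs0 hs, fun s' => ?_⟩
  by_cases h : gs A s0 ≤ gs A s'
  · exact hmax h
  · exact le_trans (le_of_not_ge h) hs

end slices


section bonnesen
variable {m : ℕ}

instance prodAddHaar : (volume : Measure (ℝ × EuclideanSpace ℝ (Fin m))).IsAddHaarMeasure :=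
  inferInstanceAs
    ((volume : Measure ℝ).prod (volume : Measure (EuclideanSpace ℝ (Fin m)))).IsAddHaarMeasure

/-- The Brunn-Minkowski inequality for compact sets in `ℝ^m`, as a proposition. -/
def BMP (m : ℕ) : Prop := ∀ A B : Set (EuclideanSpace ℝ (Fin m)), IsCompact A → IsCompact B →
  A.Nonempty → B.Nonempty → ∀ a b : ℝ, 0 ≤ a → 0 ≤ b → a ^ m ≤ volume.real A →
  b ^ m ≤ volume.real B → (a + b) ^ m ≤ volume.real (A + B)

lemma vol_zero_dim {S : Set (EuclideanSpace ℝ (Fin 0))} (hS : S.Nonempty) :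
    volume.real S = 1 := by
  have : S = univ := Set.eq_univ_of_forall fun x => by
    obtain ⟨y, hy⟩ := hS
    rwa [Subsingleton.elim x y]
  rw [this, measureReal_def, volume_euclideanSpace_eq_dirac]
  simp

lemma exists_root {x : ℝ} (hx : 0 < x) (hm : m ≠ 0) : ∃ p : ℝ, 0 < p ∧ p ^ m = x :=
  ⟨x ^ ((m : ℝ)⁻¹), Real.rpow_pos_of_pos hx _, Real.rpow_inv_natCast_pow hx.le hm⟩

lemma nonempty_of_vol_pos {X : Type*} [MeasurableSpace X] {μ : Measure X} {S : Set X}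
    (h : 0 < μ.real S) : S.Nonempty := by
  by_contra hne
  rw [not_nonempty_iff_eq_empty] at hne
  simp [hne] at h

lemma exists_vol_root {S : Set (EuclideanSpace ℝ (Fin m))} (h : 0 < volume.real S) :
    ∃ p : ℝ, 0 < p ∧ p ^ m = volume.real S := by
  rcases Nat.eq_zero_or_pos m with rfl | hm
  · exact ⟨1, one_pos, by rw [vol_zero_dim (nonempty_of_vol_pos h), pow_zero]⟩
  · exact exists_root h hm.ne'

lemma BMP.scaled (hBM : BMP m) {S S' : Set (EuclideanSpace ℝ (Fin m))} (hS : IsCompact S)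
    (hS' : IsCompact S') {l p q : ℝ} (hl : 0 < l) (hl1 : l ≤ 1) (hp : 0 < p) (hq : 0 < q)
    (h1 : l * p ^ m ≤ volume.real S) (h2 : l * q ^ m ≤ volume.real S') :
    l * (p + q) ^ m ≤ volume.real (S + S') := by
  have n1 : S.Nonempty := nonempty_of_vol_pos (lt_of_lt_of_le (by positivity) h1)
  have n2 : S'.Nonempty := nonempty_of_vol_pos (lt_of_lt_of_le (by positivity) h2)
  rcases Nat.eq_zero_or_pos m with rfl | hm
  · rw [vol_zero_dim (n1.add n2)]
    simpa using hl1
  · obtain ⟨k, hk, rfl⟩ := exists_root (m := m) hl hm.ne'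
    have := hBM S S' hS hS' n1 n2 (k * p) (k * q) (by positivity) (by positivity)
      (by rwa [mul_pow]) (by rwa [mul_pow])
    rwa [← mul_add, mul_pow] at this

lemma ofReal_vol_div {A : Set (ℝ × EuclideanSpace ℝ (Fin m))} (hA : IsCompact A) {c : ℝ}
    (hc : 0 < c) : ENNReal.ofReal (volume.real A / c)
      = ∫⁻ t in Ioi (0 : ℝ), volume {s | t * c ≤ gs A s} := by
  have h := lintegral_eq_lintegral_meas_le (volume : Measure ℝ) (f := fun s => gs A s / c)
    (Eventually.of_forall fun s => div_nonneg (gs_nonneg A s) hc.le)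
    ((gs_measurable hA).div_const c).aemeasurable
  rw [vol_eq_integral hA, ← integral_div, ofReal_integral_eq_lintegral_ofReal
    ((gs_integrable hA).div_const c)
    (Eventually.of_forall fun s => div_nonneg (gs_nonneg A s) hc.le), h]
  simp_rw [le_div_iff₀ hc]

lemma level_antitone (A : Set (ℝ × EuclideanSpace ℝ (Fin m))) {c : ℝ} (hc : 0 < c) :
    Antitone (fun t : ℝ => volume {s | t * c ≤ gs A s}) := by
  intro t t' h
  apply measure_mono
  intro s hs
  simp only [mem_ofPred_eq] at hs ⊢
  nlinarith

lemma layer_ge {A : Set (ℝ × EuclideanSpace ℝ (Fin m))} (hA : IsCompact A) {c : ℝ}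
    (hc : 0 < c) : ∫⁻ t in Ioc (0 : ℝ) 1, volume {s | t * c ≤ gs A s}
      ≤ ENNReal.ofReal (volume.real A / c) := by
  rw [ofReal_vol_div hA hc]
  exact lintegral_mono_set Ioc_subset_Ioi_self

lemma layer_le {A : Set (ℝ × EuclideanSpace ℝ (Fin m))} (hA : IsCompact A) {c : ℝ}
    (hc : 0 < c) (hle : ∀ s, gs A s ≤ c) : ENNReal.ofReal (volume.real A / c)
      ≤ ∫⁻ t in Ioc (0 : ℝ) 1, volume {s | t * c ≤ gs A s} := by
  rw [ofReal_vol_div hA hc, ← Ioc_union_Ioi_eq_Ioi (zero_le_one' ℝ)]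
  refine (lintegral_union_le _ _ _).trans ?_
  have : ∫⁻ t in Ioi (1 : ℝ), volume {s | t * c ≤ gs A s} = 0 := by
    rw [setLIntegral_congr_fun (g := fun _ => 0) measurableSet_Ioi]
    · simp
    · intro t ht
      have ht : 1 < t := ht
      have : {s | t * c ≤ gs A s} = ∅ := by
        ext s
        simp only [mem_ofPred_eq, mem_empty_iff_false, iff_false, not_le]
        have := hle s
        nlinarith
      simp [this]
  rw [this, add_zero]

lemma slice_add_subset (A B : Set (ℝ × EuclideanSpace ℝ (Fin m))) (s t : ℝ) :
    Prod.mk s ⁻¹' A + Prod.mk t ⁻¹' B ⊆ Prod.mk (s + t) ⁻¹' (A + B) := by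
  rintro _ ⟨x, hx, y, hy, rfl⟩
  exact ⟨(s, x), hx, (t, y), hy, rfl⟩

lemma bonnesen (hBM : BMP m) {A B : Set (ℝ × EuclideanSpace ℝ (Fin m))} (hA : IsCompact A)
    (hB : IsCompact B) {p q : ℝ} (hp : 0 < p) (hq : 0 < q)
    (hA1 : ∀ s, gs A s ≤ p ^ m) (hB1 : ∀ s, gs B s ≤ q ^ m)
    (hA2 : ∃ s, gs A s = p ^ m) (hB2 : ∃ s, gs B s = q ^ m) :
    (p + q) ^ m * (volume.real A / p ^ m + volume.real B / q ^ m) ≤ volume.real (A + B) := by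
  have hAB : IsCompact (A + B) := hA.add hB
  have hpm : 0 < p ^ m := by positivity
  have hqm : 0 < q ^ m := by positivity
  have hpq : 0 < (p + q) ^ m := by positivity
  have key : ENNReal.ofReal (volume.real A / p ^ m) + ENNReal.ofReal (volume.real B / q ^ m)
      ≤ ENNReal.ofReal (volume.real (A + B) / (p + q) ^ m) := by
    refine (add_le_add (layer_le hA hpm hA1) (layer_le hB hqm hB1)).trans ?_
    rw [← lintegral_add_left (level_antitone A hpm).measurable]
    refine le_trans (setLIntegral_mono' measurableSet_Ioc ?_) (layer_ge hAB hpq)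
    rintro l ⟨hl0, hl1⟩
    obtain ⟨s0, hs0⟩ := hA2
    obtain ⟨t0, ht0⟩ := hB2
    refine (bm_line (gs_level_compact hA (by positivity)) (gs_level_compact hB (by positivity))
      ⟨s0, ?_⟩ ⟨t0, ?_⟩).trans (measure_mono ?_)
    · simp only [mem_ofPred_eq]; nlinarith
    · simp only [mem_ofPred_eq]; nlinarith
    · rintro _ ⟨s, hs, t, ht, rfl⟩
      refine (hBM.scaled (slice_compact hA s) (slice_compact hB t) hl0 hl1 hp hq hs ht).trans ?_
      exact measureReal_mono (slice_add_subset A B s t)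
        (slice_compact hAB (s + t)).measure_lt_top.ne
  rw [← ENNReal.ofReal_add (by positivity) (by positivity),
    ENNReal.ofReal_le_ofReal_iff (by positivity), le_div_iff₀ hpq] at key
  linarith

/-- Hölder type inequality. -/
lemma radon_ineq {a b p q : ℝ} (ha : 0 ≤ a) (hb : 0 ≤ b) (hp : 0 < p) (hq : 0 < q) :
    (a + b) ^ (m + 1) ≤ (p + q) ^ m * (a ^ (m + 1) / p ^ m + b ^ (m + 1) / q ^ m) := by
  have hc := (convexOn_pow (𝕜 := ℝ) (m + 1)).2
    (show a / p ∈ Ici (0 : ℝ) by simp only [mem_Ici]; positivity)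
    (show b / q ∈ Ici (0 : ℝ) by simp only [mem_Ici]; positivity)
    (show (0 : ℝ) ≤ p / (p + q) by positivity) (show (0 : ℝ) ≤ q / (p + q) by positivity)
    (by field_simp)
  simp only [smul_eq_mul] at hc
  have e1 : p / (p + q) * (a / p) + q / (p + q) * (b / q) = (a + b) / (p + q) := by
    field_simp
  rw [e1, div_pow, div_le_iff₀ (by positivity)] at hc
  refine hc.trans (le_of_eq ?_)
  rw [div_pow, div_pow, pow_succ (p + q), pow_succ p, pow_succ q]
  field_simp

lemma radon_eq (hm : m ≠ 0) {a b p q : ℝ} (ha : 0 ≤ a) (hb : 0 ≤ b) (hp : 0 < p) (hq : 0 < q)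
    (h : (p + q) ^ m * (a ^ (m + 1) / p ^ m + b ^ (m + 1) / q ^ m) ≤ (a + b) ^ (m + 1)) :
    a / p = b / q := by
  by_contra hne
  have hc := (strictConvexOn_pow (n := m + 1) (by omega)).2
    (show a / p ∈ Ici (0 : ℝ) by simp only [mem_Ici]; positivity)
    (show b / q ∈ Ici (0 : ℝ) by simp only [mem_Ici]; positivity) hne
    (show (0 : ℝ) < p / (p + q) by positivity) (show (0 : ℝ) < q / (p + q) by positivity)
    (by field_simp)
  simp only [smul_eq_mul] at hc
  have e1 : p / (p + q) * (a / p) + q / (p + q) * (b / q) = (a + b) / (p + q) := by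
    field_simp
  rw [e1, div_pow, div_lt_iff₀ (by positivity)] at hc
  refine absurd (hc.trans_le ?_) (not_lt.2 h)
  apply le_of_eq
  rw [div_pow, div_pow, pow_succ (p + q), pow_succ p, pow_succ q]
  field_simp

/-- vertical product Brunn-Minkowski -/
lemma bm_prod (hBM : BMP m) {A B : Set (ℝ × EuclideanSpace ℝ (Fin m))} (hA : IsCompact A)
    (hB : IsCompact B) (hAn : A.Nonempty) (hBn : B.Nonempty) {a b : ℝ} (ha : 0 ≤ a) (hb : 0 ≤ b)
    (hAa : a ^ (m + 1) ≤ volume.real A) (hBb : b ^ (m + 1) ≤ volume.real B) :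
    (a + b) ^ (m + 1) ≤ volume.real (A + B) := by
  have hfin := (hA.add hB).measure_lt_top (μ := volume) |>.ne
  rcases ha.eq_or_lt with rfl | ha
  · obtain ⟨x, hx⟩ := hAn
    rw [zero_add]
    refine hBb.trans ?_
    have : volume.real B = volume.real ((fun z => x + z) '' B) := by
      rw [measureReal_def, measureReal_def, Set.image_add_left, measure_preimage_add]
    rw [this]
    refine measureReal_mono ?_ hfin
    rintro _ ⟨z, hz, rfl⟩
    exact ⟨x, hx, z, hz, rfl⟩
  rcases hb.eq_or_lt with rfl | hb
  · obtain ⟨x, hx⟩ := hBn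
    rw [add_zero]
    refine hAa.trans ?_
    have : volume.real A = volume.real ((fun z => x + z) '' A) := by
      rw [measureReal_def, measureReal_def, Set.image_add_left, measure_preimage_add]
    rw [this]
    refine measureReal_mono ?_ hfin
    rintro _ ⟨z, hz, rfl⟩
    exact ⟨z, hz, x, hx, add_comm _ _⟩
  obtain ⟨s, hs, hsm⟩ := gs_exists_max hA (lt_of_lt_of_le (by positivity) hAa)
  obtain ⟨t, ht, htm⟩ := gs_exists_max hB (lt_of_lt_of_le (by positivity) hBb)
  obtain ⟨p, hp, hps⟩ := exists_vol_root hs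
  obtain ⟨q, hq, hqt⟩ := exists_vol_root ht
  change p ^ m = gs A s at hps
  change q ^ m = gs B t at hqt
  refine (radon_ineq ha.le hb.le hp hq).trans (le_trans ?_
    (bonnesen hBM hA hB hp hq (by rwa [hps]) (by rwa [hqt]) ⟨s, hps.symm⟩ ⟨t, hqt.symm⟩))
  gcongr

/-- equality case of `bm_prod`: maximal slices are in proportion -/
lemma bm_prod_eq (hBM : BMP m) {A B : Set (ℝ × EuclideanSpace ℝ (Fin m))} (hA : IsCompact A)
    (hB : IsCompact B) {a b : ℝ} (ha : 0 < a) (hb : 0 < b)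
    (hAa : volume.real A = a ^ (m + 1)) (hBb : volume.real B = b ^ (m + 1))
    (h : volume.real (A + B) ≤ (a + b) ^ (m + 1)) :
    ∃ s t, 0 < gs A s ∧ 0 < gs B t ∧ (∀ s', gs A s' ≤ gs A s) ∧ (∀ t', gs B t' ≤ gs B t) ∧
      gs A s * b ^ m = gs B t * a ^ m := by
  obtain ⟨s, hs, hsm⟩ := gs_exists_max hA (by rw [hAa]; positivity)
  obtain ⟨t, ht, htm⟩ := gs_exists_max hB (by rw [hBb]; positivity)
  refine ⟨s, t, hs, ht, hsm, htm, ?_⟩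
  obtain ⟨p, hp, hps⟩ := exists_vol_root hs
  obtain ⟨q, hq, hqt⟩ := exists_vol_root ht
  change p ^ m = gs A s at hps
  change q ^ m = gs B t at hqt
  have hbon := bonnesen hBM hA hB hp hq (by rwa [hps]) (by rwa [hqt]) ⟨s, hps.symm⟩ ⟨t, hqt.symm⟩
  rw [← hps, ← hqt]
  rcases eq_or_ne m 0 with rfl | hm
  · simp
  · rw [hAa, hBb] at hbon
    have := radon_eq hm ha.le hb.le hp hq (hbon.trans h)
    rw [← mul_pow, ← mul_pow]
    rw [div_eq_div_iff hp.ne' hq.ne'] at this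
    congr 1
    linarith

end bonnesen

/-- Splitting off the direction of a unit vector. -/
lemma exists_split (m : ℕ) (ν : EuclideanSpace ℝ (Fin (m + 1))) (hν : ‖ν‖ = 1) :
    ∃ φ : EuclideanSpace ℝ (Fin (m + 1)) ≃L[ℝ] ℝ × EuclideanSpace ℝ (Fin m),
      MeasurePreserving φ volume volume ∧ (∀ x, (φ x).1 = inner ℝ ν x) ∧
      ∀ x, ‖x‖ ^ 2 = (φ x).1 ^ 2 + ‖(φ x).2‖ ^ 2 := by
  have hfin : Module.finrank ℝ (WithLp 2 (ℝ × EuclideanSpace ℝ (Fin m))) = m + 1 := by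
    rw [(WithLp.linearEquiv 2 ℝ (ℝ × EuclideanSpace ℝ (Fin m))).finrank_eq]
    simp [add_comm]
  let ψ : (WithLp 2 (ℝ × EuclideanSpace ℝ (Fin m))) ≃ₗᵢ[ℝ] EuclideanSpace ℝ (Fin (m + 1)) :=
    ((stdOrthonormalBasis ℝ (WithLp 2 (ℝ × EuclideanSpace ℝ (Fin m)))).reindex (finCongr hfin)).repr
  let e : (WithLp 2 (ℝ × EuclideanSpace ℝ (Fin m))) := WithLp.toLp 2 (1, 0)
  have he : ‖e‖ = 1 := by
    simp [e, WithLp.prod_norm_eq_of_L2]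
  have hpe : ‖ψ.symm ν‖ = ‖e‖ := by rw [he, LinearIsometryEquiv.norm_map, hν]
  let ρ : (WithLp 2 (ℝ × EuclideanSpace ℝ (Fin m))) ≃ₗᵢ[ℝ] (WithLp 2 (ℝ × EuclideanSpace ℝ (Fin m))) := Submodule.reflection (ℝ ∙ (ψ.symm ν - e))ᗮ
  have hρ : ρ (ψ.symm ν) = e := Submodule.reflection_sub hpe
  let χ : EuclideanSpace ℝ (Fin (m + 1)) ≃ₗᵢ[ℝ] (WithLp 2 (ℝ × EuclideanSpace ℝ (Fin m))) := ψ.symm.trans ρ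
  have hχ : χ ν = e := hρ
  refine ⟨χ.toContinuousLinearEquiv.trans (WithLp.prodContinuousLinearEquiv 2 ℝ ℝ _), ?_, ?_, ?_⟩
  · exact (WithLp.volume_preserving_ofLp ℝ (EuclideanSpace ℝ (Fin m))).comp χ.measurePreserving
  · intro x
    have : inner ℝ ν x = inner ℝ (χ ν) (χ x) := (χ.inner_map_map ν x).symm
    rw [this, hχ]
    simp [e, WithLp.prod_inner_apply]
  · intro x
    rw [← χ.norm_map x, WithLp.prod_norm_sq_eq_of_L2]
    simp

lemma vol_image_split {m : ℕ} {φ : EuclideanSpace ℝ (Fin (m + 1)) ≃L[ℝ] ℝ × EuclideanSpace ℝ (Fin m)}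
    (hφ : MeasurePreserving φ volume volume) (S : Set (EuclideanSpace ℝ (Fin (m + 1)))) :
    volume (φ '' S) = volume S := by
  have := hφ.measure_preimage_emb φ.toHomeomorph.measurableEmbedding (φ '' S)
  rw [← this, preimage_image_eq _ φ.injective]

theorem bm_all (m : ℕ) : BMP m := by
  induction m with
  | zero =>
    intro A B _ _ hA hB a b _ _ _ _
    rw [vol_zero_dim (hA.add hB), pow_zero]
  | succ m ih =>
    intro A B hA hB hAn hBn a b ha hb h1 h2
    obtain ⟨φ, hφ, -, -⟩ := exists_split m (EuclideanSpace.single 0 1) (by simp)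
    have h := bm_prod ih (hA.image φ.continuous) (hB.image φ.continuous) (hAn.image _)
      (hBn.image _) ha hb (by rwa [measureReal_def, vol_image_split hφ])
      (by rwa [measureReal_def, vol_image_split hφ])
    have e : φ '' A + φ '' B = φ '' (A + B) := (Set.image_add φ).symm
    rwa [e, measureReal_def, vol_image_split hφ] at h


section cuts
variable {m : ℕ}

/-- restriction to a slab -/
def restr (A : Set (ℝ × EuclideanSpace ℝ (Fin m))) (I : Set ℝ) :
    Set (ℝ × EuclideanSpace ℝ (Fin m)) := A ∩ Prod.fst ⁻¹' I

def ms (A : Set (ℝ × EuclideanSpace ℝ (Fin m))) (s : ℝ) : ℝ := volume.real (restr A (Iic s))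

lemma restr_compact {A : Set (ℝ × EuclideanSpace ℝ (Fin m))} (hA : IsCompact A) {I : Set ℝ}
    (hI : IsClosed I) : IsCompact (restr A I) :=
  hA.inter_right (hI.preimage continuous_fst)

lemma gs_restr_mem (A : Set (ℝ × EuclideanSpace ℝ (Fin m))) {I : Set ℝ} {s : ℝ} (hs : s ∈ I) :
    gs (restr A I) s = gs A s := by
  have : Prod.mk s ⁻¹' (restr A I) = Prod.mk s ⁻¹' A := by
    ext y; simp [restr, hs]
  rw [gs, gs, this]

lemma gs_restr_notMem (A : Set (ℝ × EuclideanSpace ℝ (Fin m))) {I : Set ℝ} {s : ℝ} (hs : s ∉ I) :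
    gs (restr A I) s = 0 := by
  have : Prod.mk s ⁻¹' (restr A I) = ∅ := by
    ext y; simp [restr, hs]
  rw [gs, this]; simp

lemma vol_restr {A : Set (ℝ × EuclideanSpace ℝ (Fin m))} (hA : IsCompact A) {I : Set ℝ}
    (hI : IsClosed I) : volume.real (restr A I) = ∫ s in I, gs A s := by
  rw [vol_eq_integral (restr_compact hA hI), ← integral_indicator hI.measurableSet]
  congr 1
  ext s
  by_cases hs : s ∈ I
  · rw [indicator_of_mem hs, gs_restr_mem A hs]
  · rw [indicator_of_notMem hs, gs_restr_notMem A hs]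

lemma ms_eq {A : Set (ℝ × EuclideanSpace ℝ (Fin m))} (hA : IsCompact A) (s : ℝ) :
    ms A s = ∫ u in Iic s, gs A u := vol_restr hA isClosed_Iic

lemma ms_sub {A : Set (ℝ × EuclideanSpace ℝ (Fin m))} (hA : IsCompact A) (s t : ℝ) :
    ms A t = ms A s + ∫ u in s..t, gs A u := by
  rw [ms_eq hA, ms_eq hA, ← intervalIntegral.integral_Iic_sub_Iic (gs_integrable hA).integrableOn
    (gs_integrable hA).integrableOn]
  ring

lemma ms_continuous {A : Set (ℝ × EuclideanSpace ℝ (Fin m))} (hA : IsCompact A) :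
    Continuous (ms A) := by
  have : ms A = fun t => ms A 0 + ∫ u in (0 : ℝ)..t, gs A u := by
    ext t; exact ms_sub hA 0 t
  rw [this]
  exact continuous_const.add (intervalIntegral.continuous_primitive
    (fun a b => (gs_integrable hA).intervalIntegrable) 0)

lemma ms_mono {A : Set (ℝ × EuclideanSpace ℝ (Fin m))} (hA : IsCompact A) : Monotone (ms A) := by
  intro s t h
  refine measureReal_mono ?_ (restr_compact hA isClosed_Iic).measure_lt_top.ne
  exact inter_subset_inter_right _ (preimage_mono (Iic_subset_Iic.2 h))

lemma ms_nonneg (A : Set (ℝ × EuclideanSpace ℝ (Fin m))) (s : ℝ) : 0 ≤ ms A s :=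
  measureReal_nonneg

lemma ms_le {A : Set (ℝ × EuclideanSpace ℝ (Fin m))} (hA : IsCompact A) (s : ℝ) :
    ms A s ≤ volume.real A :=
  measureReal_mono inter_subset_left hA.measure_lt_top.ne

lemma vol_restr_Icc {A : Set (ℝ × EuclideanSpace ℝ (Fin m))} (hA : IsCompact A) {s t : ℝ}
    (h : s ≤ t) : volume.real (restr A (Icc s t)) = ms A t - ms A s := by
  rw [vol_restr hA isClosed_Icc, ms_sub hA s t, intervalIntegral.integral_of_le h,
    integral_Icc_eq_integral_Ioc]
  ring

lemma vol_restr_Ici {A : Set (ℝ × EuclideanSpace ℝ (Fin m))} (hA : IsCompact A) (s : ℝ) :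
    volume.real (restr A (Ici s)) = volume.real A - ms A s := by
  rw [vol_restr hA isClosed_Ici, ms_eq hA, vol_eq_integral hA, integral_Ici_eq_integral_Ioi,
    ← integral_add_compl (measurableSet_Iic (a := s)) (gs_integrable hA), compl_Iic]
  ring

lemma exists_ms_bot {A : Set (ℝ × EuclideanSpace ℝ (Fin m))} (hA : IsCompact A) :
    ∃ s, ms A s = 0 := by
  obtain ⟨b, hb⟩ := (hA.image continuous_fst).bddBelow
  refine ⟨b - 1, ?_⟩
  have : restr A (Iic (b - 1)) = ∅ := by
    ext x
    simp only [restr, mem_inter_iff, mem_preimage, mem_Iic, mem_empty_iff_false, iff_false, not_and]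
    intro hx h
    have := hb ⟨x, hx, rfl⟩
    linarith
  rw [ms, this]; simp

lemma exists_ms_top {A : Set (ℝ × EuclideanSpace ℝ (Fin m))} (hA : IsCompact A) :
    ∃ s, ms A s = volume.real A := by
  obtain ⟨b, hb⟩ := (hA.image continuous_fst).bddAbove
  refine ⟨b, ?_⟩
  have : restr A (Iic b) = A := by
    ext x
    simp only [restr, mem_inter_iff, mem_preimage, mem_Iic, and_iff_left_iff_imp]
    intro hx
    exact hb ⟨x, hx, rfl⟩
  rw [ms, this]

lemma exists_ms_eq {A : Set (ℝ × EuclideanSpace ℝ (Fin m))} (hA : IsCompact A) {c : ℝ}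
    (h0 : 0 ≤ c) (h1 : c ≤ volume.real A) : ∃ s, ms A s = c := by
  obtain ⟨a, ha⟩ := exists_ms_bot hA
  obtain ⟨b, hb⟩ := exists_ms_top hA
  exact mem_range_of_exists_le_of_exists_ge (ms_continuous hA) ⟨a, by rwa [ha]⟩ ⟨b, by rwa [hb]⟩

/-- Brunn-Minkowski for proportional pieces -/
lemma piece {A D : Set (ℝ × EuclideanSpace ℝ (Fin m))} (hA : IsCompact A) (hD : IsCompact D)
    {ρ : ℝ} (hρ : 0 < ρ) (h : volume.real D = ρ ^ (m + 1) * volume.real A) :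
    (1 + ρ) ^ (m + 1) * volume.real A ≤ volume.real (A + D) := by
  rcases (measureReal_nonneg (μ := volume) (s := A)).eq_or_lt with h0 | h0
  · rw [← h0, mul_zero]; exact measureReal_nonneg
  · obtain ⟨a, ha, haA⟩ := exists_root (m := m + 1) h0 (by omega)
    have hd : 0 < volume.real D := by rw [h]; positivity
    have := bm_prod (bm_all m) hA hD (nonempty_of_vol_pos h0) (nonempty_of_vol_pos hd) ha.le
      (b := ρ * a) (by positivity) haA.le (by rw [h, mul_pow, haA])
    refine le_trans (le_of_eq ?_) this
    rw [← haA, ← mul_pow]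
    ring

lemma restr_add_subset (A D : Set (ℝ × EuclideanSpace ℝ (Fin m))) (I J L : Set ℝ)
    (h : ∀ x ∈ I, ∀ y ∈ J, x + y ∈ L) : restr A I + restr D J ⊆ restr (A + D) L := by
  rintro _ ⟨x, ⟨hx, hxI⟩, y, ⟨hy, hyJ⟩, rfl⟩
  exact ⟨⟨x, hx, y, hy, rfl⟩, h _ hxI _ hyJ⟩

/-- The mass distribution of the sum is determined in the equality case. -/
lemma ms_add {A D : Set (ℝ × EuclideanSpace ℝ (Fin m))} (hA : IsCompact A) (hD : IsCompact D)
    {ρ : ℝ} (hρ : 0 < ρ) (h : volume.real D = ρ ^ (m + 1) * volume.real A)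
    (heq : volume.real (A + D) ≤ (1 + ρ) ^ (m + 1) * volume.real A) {s t : ℝ}
    (hst : ms D t = ρ ^ (m + 1) * ms A s) :
    ms (A + D) (s + t) = (1 + ρ) ^ (m + 1) * ms A s := by
  have hAD := hA.add hD
  have h1 := piece (restr_compact hA (isClosed_Iic (a := s)))
    (restr_compact hD (isClosed_Iic (a := t))) hρ hst
  have h2 := piece (restr_compact hA (isClosed_Ici (a := s)))
    (restr_compact hD (isClosed_Ici (a := t))) hρ (by
      rw [vol_restr_Ici hA, vol_restr_Ici hD, h, hst]; ring)
  have h3 : volume.real (restr A (Iic s) + restr D (Iic t)) ≤ ms (A + D) (s + t) := by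
    refine measureReal_mono (restr_add_subset _ _ _ _ _ ?_)
      (restr_compact hAD isClosed_Iic).measure_lt_top.ne
    intro x hx y hy
    exact add_le_add (mem_Iic.1 hx) hy
  have h4 : volume.real (restr A (Ici s) + restr D (Ici t)) ≤
      volume.real (restr (A + D) (Ici (s + t))) := by
    refine measureReal_mono (restr_add_subset _ _ _ _ _ ?_)
      (restr_compact hAD isClosed_Ici).measure_lt_top.ne
    intro x hx y hy
    exact add_le_add (mem_Ici.1 hx) hy
  rw [vol_restr_Ici hAD] at h4
  rw [vol_restr_Ici hA] at h2
  change (1 + ρ) ^ (m + 1) * ms A s ≤ _ at h1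
  nlinarith

/-- maximal slices in matched slabs are in proportion. -/
lemma slab_max {A D : Set (ℝ × EuclideanSpace ℝ (Fin m))} (hA : IsCompact A) (hD : IsCompact D)
    {ρ : ℝ} (hρ : 0 < ρ) (h : volume.real D = ρ ^ (m + 1) * volume.real A)
    (heq : volume.real (A + D) ≤ (1 + ρ) ^ (m + 1) * volume.real A) {s₁ s₂ t₁ t₂ : ℝ}
    (hs : s₁ ≤ s₂) (ht : t₁ ≤ t₂)
    (hst₁ : ms D t₁ = ρ ^ (m + 1) * ms A s₁) (hst₂ : ms D t₂ = ρ ^ (m + 1) * ms A s₂)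
    (hlt : ms A s₁ < ms A s₂) :
    ∃ s ∈ Icc s₁ s₂, ∃ t ∈ Icc t₁ t₂, (∀ s' ∈ Icc s₁ s₂, gs A s' ≤ gs A s) ∧
      (∀ t' ∈ Icc t₁ t₂, gs D t' ≤ gs D t) ∧ gs A s * ρ ^ m = gs D t := by
  have hAD := hA.add hD
  have hA2 := restr_compact hA (isClosed_Icc (a := s₁) (b := s₂))
  have hD2 := restr_compact hD (isClosed_Icc (a := t₁) (b := t₂))
  have vA := vol_restr_Icc hA hs
  have vD := vol_restr_Icc hD ht
  obtain ⟨a, ha, haA⟩ := exists_root (m := m + 1) (sub_pos.2 hlt) (by omega)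
  have hsum : volume.real (restr A (Icc s₁ s₂) + restr D (Icc t₁ t₂)) ≤ (a + ρ * a) ^ (m + 1) := by
    have h4 : volume.real (restr A (Icc s₁ s₂) + restr D (Icc t₁ t₂)) ≤
        volume.real (restr (A + D) (Icc (s₁ + t₁) (s₂ + t₂))) := by
      refine measureReal_mono (restr_add_subset _ _ _ _ _ ?_)
        (restr_compact hAD isClosed_Icc).measure_lt_top.ne
      intro x hx y hy
      exact ⟨add_le_add hx.1 hy.1, add_le_add hx.2 hy.2⟩
    rw [vol_restr_Icc hAD (add_le_add hs ht), ms_add hA hD hρ h heq hst₁,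
      ms_add hA hD hρ h heq hst₂, ← mul_sub, ← haA, ← mul_pow] at h4
    refine h4.trans (le_of_eq ?_)
    ring
  obtain ⟨s, t, hs0, ht0, hsm, htm, hst⟩ := bm_prod_eq (bm_all m) hA2 hD2 ha
    (b := ρ * a) (by positivity) (by rw [vA, haA])
    (by rw [vD, hst₁, hst₂, ← mul_sub, mul_pow, haA]) hsum
  have hsI : s ∈ Icc s₁ s₂ := by
    by_contra hc
    rw [gs_restr_notMem _ hc] at hs0
    exact lt_irrefl _ hs0
  have htI : t ∈ Icc t₁ t₂ := by
    by_contra hc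
    rw [gs_restr_notMem _ hc] at ht0
    exact lt_irrefl _ ht0
  refine ⟨s, hsI, t, htI, ?_, ?_, ?_⟩
  · intro s' hs'
    have := hsm s'
    rwa [gs_restr_mem _ hs', gs_restr_mem _ hsI] at this
  · intro s' hs'
    have := htm s'
    rwa [gs_restr_mem _ hs', gs_restr_mem _ htI] at this
  · rw [gs_restr_mem _ hsI, gs_restr_mem _ htI, mul_pow] at hst
    have ham : a ^ m ≠ 0 := by positivity
    apply mul_right_cancel₀ ham
    linarith

end cuts

section theball
variable {m : ℕ}

/-- the ball in the product -/
def DD (m : ℕ) (t : ℝ) : Set (ℝ × EuclideanSpace ℝ (Fin m)) := {x | x.1 ^ 2 + ‖x.2‖ ^ 2 ≤ t ^ 2}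

lemma DD_compact {t : ℝ} (ht : 0 < t) : IsCompact (DD m t) := by
  refine (isCompact_closedBall (0 : ℝ × EuclideanSpace ℝ (Fin m)) t).of_isClosed_subset ?_ ?_
  · exact isClosed_le (by fun_prop) (by fun_prop)
  · intro x hx
    have hx : x.1 ^ 2 + ‖x.2‖ ^ 2 ≤ t ^ 2 := hx
    rw [mem_closedBall_zero_iff, Prod.norm_def]
    apply max_le
    · rw [Real.norm_eq_abs]
      exact abs_le_of_sq_le_sq (by nlinarith [sq_nonneg ‖x.2‖]) ht.le
    · exact le_of_sq_le_sq (by nlinarith [sq_nonneg x.1]) ht.le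

lemma DD_gs {t u : ℝ} (hu : u ∈ Icc (-t) t) : gs (DD m t) u =
    √(t ^ 2 - u ^ 2) ^ m * volume.real (closedBall (0 : EuclideanSpace ℝ (Fin m)) 1) := by
  have h0 : 0 ≤ t ^ 2 - u ^ 2 := by nlinarith [hu.1, hu.2]
  have : Prod.mk u ⁻¹' (DD m t) = closedBall 0 (√(t ^ 2 - u ^ 2)) := by
    ext y
    simp only [DD, mem_preimage, mem_ofPred_eq, mem_closedBall_zero_iff]
    rw [Real.le_sqrt (norm_nonneg _) h0]
    constructor <;> intro h <;> linarith
  rw [gs, this, Measure.addHaar_real_closedBall' _ _ (Real.sqrt_nonneg _)]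
  simp

lemma DD_gs_out {t u : ℝ} (ht : 0 < t) (hu : u ∉ Icc (-t) t) : gs (DD m t) u = 0 := by
  have : Prod.mk u ⁻¹' (DD m t) = ∅ := by
    ext y
    simp only [DD, mem_preimage, mem_ofPred_eq, mem_empty_iff_false, iff_false, not_le]
    have h2 : t < |u| := by
      by_contra hc
      exact hu (abs_le.1 (not_lt.1 hc))
    have : t ^ 2 < u ^ 2 := by rw [← sq_abs u]; nlinarith
    nlinarith [sq_nonneg ‖y‖]
  rw [gs, this]; simp

lemma DD_gs_even (t u : ℝ) : gs (DD m t) (-u) = gs (DD m t) u := by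
  have : Prod.mk (-u) ⁻¹' (DD m t) = Prod.mk u ⁻¹' (DD m t) := by
    ext y; simp [DD]
  rw [gs, gs, this]

lemma DD_gs_pos {t u : ℝ} (hu : u ∈ Ioo (-t) t) : 0 < gs (DD m t) u := by
  rw [DD_gs (Ioo_subset_Icc_self hu)]
  have h0 : 0 < t ^ 2 - u ^ 2 := by nlinarith [hu.1, hu.2]
  have : 0 < volume.real (closedBall (0 : EuclideanSpace ℝ (Fin m)) 1) :=
    ENNReal.toReal_pos (measure_closedBall_pos _ _ one_pos).ne' measure_closedBall_lt_top.ne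
  have := Real.sqrt_pos.2 h0
  positivity

lemma DD_gs_cont {t u : ℝ} (hu : u ∈ Ioo (-t) t) : ContinuousAt (gs (DD m t)) u := by
  have : (fun u => √(t ^ 2 - u ^ 2) ^ m * volume.real (closedBall (0 : EuclideanSpace ℝ (Fin m)) 1))
      =ᶠ[nhds u] gs (DD m t) := by
    filter_upwards [isOpen_Ioo.mem_nhds hu] with v hv
    rw [DD_gs (Ioo_subset_Icc_self hv)]
  refine ContinuousAt.congr ?_ this
  fun_prop

lemma DD_ms_bot {t : ℝ} (ht : 0 < t) : ms (DD m t) (-t) = 0 := by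
  rw [ms_eq (DD_compact ht), integral_Iic_eq_integral_Iio]
  apply setIntegral_eq_zero_of_forall_eq_zero
  intro u hu
  exact DD_gs_out ht (fun h => absurd h.1 (not_le.2 hu))

lemma DD_ms_top {t : ℝ} (ht : 0 < t) : ms (DD m t) t = volume.real (DD m t) := by
  have : restr (DD m t) (Iic t) = DD m t := by
    ext x
    simp only [restr, mem_inter_iff, mem_preimage, mem_Iic, and_iff_left_iff_imp]
    intro hx
    have hx : x.1 ^ 2 + ‖x.2‖ ^ 2 ≤ t ^ 2 := hx
    exact le_of_sq_le_sq (by nlinarith [sq_nonneg ‖x.2‖]) ht.le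
  rw [ms, this]

lemma DD_ms_strict {t : ℝ} (ht : 0 < t) : StrictMonoOn (ms (DD m t)) (Icc (-t) t) := by
  intro u hu v hv huv
  rw [ms_sub (DD_compact ht) u v]
  have := intervalIntegral.intervalIntegral_pos_of_pos_on
    ((gs_integrable (DD_compact (m := m) ht)).intervalIntegrable (a := u) (b := v))
    (fun x hx => DD_gs_pos ⟨lt_of_le_of_lt hu.1 hx.1, lt_of_lt_of_le hx.2 hv.2⟩) huv
  linarith

end theball


section equality
variable {m : ℕ}

lemma no_gap {A : Set (ℝ × EuclideanSpace ℝ (Fin m))} (hA : IsCompact A) {t ρ : ℝ} (ht : 0 < t)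
    (hρ : 0 < ρ) (h : volume.real (DD m t) = ρ ^ (m + 1) * volume.real A)
    (heq : volume.real (A + DD m t) ≤ (1 + ρ) ^ (m + 1) * volume.real A) {s₁ s₂ τ : ℝ}
    (hs : s₁ < s₂) (hτ : τ ∈ Ioo (-t) t) (hst : ms (DD m t) τ = ρ ^ (m + 1) * ms A s₁) :
    ms A s₁ < ms A s₂ := by
  have hD := DD_compact (m := m) ht
  have hAD := hA.add hD
  refine lt_of_le_of_ne (ms_mono hA hs.le) fun hcon => ?_
  have hpos : 0 < ms A s₁ := by
    have h1 := DD_ms_strict (m := m) ht (left_mem_Icc.2 (by linarith)) (Ioo_subset_Icc_self hτ) hτ.1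
    rw [DD_ms_bot ht, hst] at h1
    exact pos_of_mul_pos_right h1 (by positivity)
  have hne : (restr A (Iic s₁)).Nonempty := nonempty_of_vol_pos hpos
  obtain ⟨k, hk, hkmax⟩ := (restr_compact hA (isClosed_Iic (a := s₁))).exists_isMaxOn hne
    continuous_fst.continuousOn
  have hk1 : k.1 ≤ s₁ := hk.2
  have hms : ms A k.1 = ms A s₁ := by
    have : restr A (Iic k.1) = restr A (Iic s₁) := by
      ext x
      constructor
      · rintro ⟨hx, hx1⟩
        exact ⟨hx, le_trans (mem_Iic.1 hx1) hk1⟩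
      · intro hx
        exact ⟨hx.1, hkmax hx⟩
    rw [ms, this, ms]
  have e1 := ms_add hA hD hρ h heq (s := k.1) (t := τ) (by rw [hst, hms])
  have e2 := ms_add hA hD hρ h heq (s := s₂) (t := τ) (by rw [hst, hcon])
  have hz : volume.real (restr (A + DD m t) (Icc (k.1 + τ) (s₂ + τ))) = 0 := by
    rw [vol_restr_Icc hAD (by linarith), e1, e2, hms, hcon, sub_self]
  let O : Set (ℝ × EuclideanSpace ℝ (Fin m)) :=
    {x | k.1 + τ < x.1} ∩ {x | x.1 < s₂ + τ} ∩ {x | (x - k).1 ^ 2 + ‖(x - k).2‖ ^ 2 < t ^ 2}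
  have hO : IsOpen O := by
    refine ((isOpen_lt ?_ ?_).inter (isOpen_lt ?_ ?_)).inter (isOpen_lt ?_ ?_) <;> fun_prop
  have hsub : O ⊆ restr (A + DD m t) (Icc (k.1 + τ) (s₂ + τ)) := by
    rintro x ⟨⟨h1, h2⟩, h3⟩
    refine ⟨⟨k, hk.1, x - k, ?_, by simp⟩, ⟨le_of_lt h1, le_of_lt h2⟩⟩
    exact (show (x - k).1 ^ 2 + ‖(x - k).2‖ ^ 2 < t ^ 2 from h3).le
  have hOne : O.Nonempty := by
    obtain ⟨e, he0, he1⟩ := exists_between (show (0 : ℝ) < min (s₂ - k.1) (t - τ) by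
      apply lt_min <;> linarith [hτ.2])
    have he2 := lt_of_lt_of_le he1 (min_le_left _ _)
    have he3 := lt_of_lt_of_le he1 (min_le_right _ _)
    refine ⟨k + (τ + e, 0), ⟨?_, ?_⟩, ?_⟩
    · simp only [mem_ofPred_eq, Prod.fst_add]; linarith
    · simp only [mem_ofPred_eq, Prod.fst_add]; linarith
    · simp only [mem_ofPred_eq, add_sub_cancel_left, norm_zero]
      nlinarith [hτ.1]
  have h1 : 0 < volume O := hO.measure_pos volume hOne
  have h2 : volume (restr (A + DD m t) (Icc (k.1 + τ) (s₂ + τ))) = 0 := by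
    rwa [measureReal_eq_zero_iff (restr_compact hAD isClosed_Icc).measure_lt_top.ne] at hz
  exact h1.ne' (measure_mono_null hsub h2)

/-- properties of the transport map -/
structure Transport (A : Set (ℝ × EuclideanSpace ℝ (Fin m))) (t ρ : ℝ) (T : ℝ → ℝ) : Prop where
  mem : ∀ s, T s ∈ Icc (-t) t
  eq : ∀ s, ms (DD m t) (T s) = ρ ^ (m + 1) * ms A s

lemma exists_transport {A : Set (ℝ × EuclideanSpace ℝ (Fin m))} (hA : IsCompact A) {t ρ : ℝ}
    (ht : 0 < t) (hρ : 0 < ρ) (h : volume.real (DD m t) = ρ ^ (m + 1) * volume.real A) :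
    ∃ T, Transport A t ρ T := by
  have : ∀ s, ∃ τ ∈ Icc (-t) t, ms (DD m t) τ = ρ ^ (m + 1) * ms A s := by
    intro s
    have h1 := intermediate_value_Icc (show -t ≤ t by linarith)
      (ms_continuous (DD_compact (m := m) ht)).continuousOn
    have h2 : ρ ^ (m + 1) * ms A s ∈ Icc (ms (DD m t) (-t)) (ms (DD m t) t) := by
      rw [DD_ms_bot ht, DD_ms_top ht, h]
      refine ⟨mul_nonneg (by positivity) (ms_nonneg A s), ?_⟩
      gcongr
      exact ms_le hA s
    obtain ⟨τ, h3, h4⟩ := h1 h2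
    exact ⟨τ, h3, h4⟩
  choose T hT1 hT2 using this
  exact ⟨T, hT1, hT2⟩

lemma Transport.mono {A : Set (ℝ × EuclideanSpace ℝ (Fin m))} (hA : IsCompact A) {t ρ : ℝ}
    {T : ℝ → ℝ} (ht : 0 < t) (hρ : 0 < ρ) (hT : Transport A t ρ T) : Monotone T := by
  intro s s' hss
  rw [← (DD_ms_strict (m := m) ht).le_iff_le (hT.mem s) (hT.mem s'), hT.eq, hT.eq]
  gcongr
  exact ms_mono hA hss

lemma Transport.uniq {A : Set (ℝ × EuclideanSpace ℝ (Fin m))} {t ρ : ℝ}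
    {T : ℝ → ℝ} (ht : 0 < t) (hT : Transport A t ρ T) {s τ : ℝ} (hτ : τ ∈ Icc (-t) t)
    (h : ms (DD m t) τ = ρ ^ (m + 1) * ms A s) : T s = τ := by
  apply (DD_ms_strict (m := m) ht).injOn (hT.mem s) hτ
  rw [h, hT.eq]

lemma Transport.cont {A : Set (ℝ × EuclideanSpace ℝ (Fin m))} (hA : IsCompact A) {t ρ : ℝ}
    {T : ℝ → ℝ} (ht : 0 < t) (hT : Transport A t ρ T) {s : ℝ}
    (hs : T s ∈ Ioo (-t) t) : ContinuousAt T s := by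
  have hst := DD_ms_strict (m := m) ht
  have hc : Continuous fun s => ρ ^ (m + 1) * ms A s := continuous_const.mul (ms_continuous hA)
  have hI : Icc (-t) t ∈ nhds (T s) := Icc_mem_nhds hs.1 hs.2
  rw [ContinuousAt, tendsto_order]
  constructor
  · intro a ha
    obtain ⟨b, hb1, hb2⟩ := exists_between (max_lt ha hs.1)
    have hbI : b ∈ Icc (-t) t := ⟨((le_max_right _ _).trans hb1.le), (hb2.trans hs.2).le⟩
    have h1 : ms (DD m t) b < ρ ^ (m + 1) * ms A s := by
      rw [← hT.eq]; exact hst hbI (hT.mem s) hb2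
    filter_upwards [hc.continuousAt.eventually (lt_mem_nhds h1)] with s' hs'
    rw [← hT.eq, hst.lt_iff_lt hbI (hT.mem s')] at hs'
    exact lt_of_le_of_lt ((le_max_left _ _).trans hb1.le) hs'
  · intro a ha
    obtain ⟨b, hb1, hb2⟩ := exists_between (lt_min ha hs.2)
    have hbI : b ∈ Icc (-t) t := ⟨(hs.1.trans hb1).le, hb2.le.trans (min_le_right _ _)⟩
    have h1 : ρ ^ (m + 1) * ms A s < ms (DD m t) b := by
      rw [← hT.eq]; exact hst (hT.mem s) hbI hb1
    filter_upwards [hc.continuousAt.eventually (gt_mem_nhds h1)] with s' hs'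
    rw [← hT.eq, hst.lt_iff_lt (hT.mem s') hbI] at hs'
    exact lt_of_lt_of_le hs' (hb2.le.trans (min_le_left _ _))

lemma Transport.slices {A : Set (ℝ × EuclideanSpace ℝ (Fin m))} (hA : IsCompact A) {t ρ : ℝ}
    {T : ℝ → ℝ} (ht : 0 < t) (hρ : 0 < ρ)
    (h : volume.real (DD m t) = ρ ^ (m + 1) * volume.real A)
    (heq : volume.real (A + DD m t) ≤ (1 + ρ) ^ (m + 1) * volume.real A)
    (hT : Transport A t ρ T) {s : ℝ}
    (hs : T s ∈ Ioo (-t) t) : gs A s * ρ ^ m = gs (DD m t) (T s) := by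
  have main : ∀ ε : ℝ, 0 < ε → gs A s * ρ ^ m ≤ gs (DD m t) (T s) + ε ∧
      gs (DD m t) (T s) ≤ (gs A s + ε) * ρ ^ m := by
    intro ε hε
    obtain ⟨η, hη, hη'⟩ := Metric.eventually_nhds_iff.1
      ((DD_gs_cont (m := m) hs).eventually (gt_mem_nhds (lt_add_of_pos_right _ hε)))
    obtain ⟨δ, hδ, hδ'⟩ := Metric.eventually_nhds_iff.1
      ((hT.cont hA ht hs).eventually (Metric.ball_mem_nhds _ hη))
    obtain ⟨δ₂, hδ₂, hδ₂'⟩ := Metric.eventually_nhds_iff.1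
      (gs_usc hA s (gs A s + ε) (lt_add_of_pos_right _ hε))
    obtain ⟨d, hd0, hd⟩ := exists_between (lt_min hδ hδ₂)
    have hd1 := lt_of_lt_of_le hd (min_le_left _ _)
    have hd2 := lt_of_lt_of_le hd (min_le_right _ _)
    have hTm := hT.mono hA ht hρ
    have hlt : ms A (s - d) < ms A (s + d) :=
      lt_of_le_of_lt (ms_mono hA (by linarith))
        (no_gap hA ht hρ h heq (show s < s + d by linarith) hs (hT.eq s))
    obtain ⟨s', hs', τ, hτ, hmax1, hmax2, hkey⟩ := slab_max hA (DD_compact ht) hρ h heq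
      (show s - d ≤ s + d by linarith) (hTm (show s - d ≤ s + d by linarith))
      (hT.eq _) (hT.eq _) hlt
    have hτT : dist τ (T s) < η := by
      have e1 := hδ' (y := s - d) (by rw [Real.dist_eq, abs_lt]; constructor <;> linarith)
      have e2 := hδ' (y := s + d) (by rw [Real.dist_eq, abs_lt]; constructor <;> linarith)
      rw [Real.dist_eq, abs_lt] at e1 e2
      rw [Real.dist_eq, abs_lt]
      constructor <;> linarith [hτ.1, hτ.2]
    constructor
    · have e1 := hmax1 s ⟨by linarith, by linarith⟩
      have e2 := hη' hτT
      calc gs A s * ρ ^ m ≤ gs A s' * ρ ^ m := by gcongr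
        _ = gs (DD m t) τ := hkey
        _ ≤ _ := le_of_lt e2
    · have e1 := hmax2 (T s) ⟨hTm (by linarith), hTm (by linarith)⟩
      have e2 : gs A s' < gs A s + ε :=
        hδ₂' (y := s') (by rw [Real.dist_eq, abs_lt]; constructor <;> linarith [hs'.1, hs'.2])
      calc gs (DD m t) (T s) ≤ gs (DD m t) τ := e1
        _ = gs A s' * ρ ^ m := hkey.symm
        _ ≤ _ := by gcongr
  have hρm : 0 < ρ ^ m := by positivity
  apply le_antisymm
  · exact le_of_forall_pos_le_add fun ε hε => (main ε hε).1
  · refine le_of_forall_pos_le_add fun ε hε => ?_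
    have := (main (ε / ρ ^ m) (by positivity)).2
    rwa [add_mul, div_mul_cancel₀ _ hρm.ne'] at this

lemma ms_hasStrictDerivAt {A : Set (ℝ × EuclideanSpace ℝ (Fin m))} (hA : IsCompact A) {s : ℝ}
    (hc : ContinuousAt (gs A) s) : HasStrictDerivAt (ms A) (gs A s) s := by
  have : ms A = fun t => ms A 0 + ∫ u in (0 : ℝ)..t, gs A u := by
    ext t; exact ms_sub hA 0 t
  rw [this]
  exact (intervalIntegral.integral_hasStrictDerivAt_right
    ((gs_integrable hA).intervalIntegrable)
    (gs_measurable hA).stronglyMeasurable.stronglyMeasurableAtFilter hc).const_add _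

lemma Transport.deriv {A : Set (ℝ × EuclideanSpace ℝ (Fin m))} (hA : IsCompact A) {t ρ : ℝ}
    {T : ℝ → ℝ} (ht : 0 < t) (hρ : 0 < ρ)
    (h : volume.real (DD m t) = ρ ^ (m + 1) * volume.real A)
    (heq : volume.real (A + DD m t) ≤ (1 + ρ) ^ (m + 1) * volume.real A)
    (hT : Transport A t ρ T) {s : ℝ}
    (hs : T s ∈ Ioo (-t) t) : HasDerivAt T ρ s := by
  have hρm : 0 < ρ ^ m := by positivity
  have hcT := hT.cont hA ht hs
  have hgc : ContinuousAt (gs A) s := by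
    have h1 : (fun s => gs (DD m t) (T s) / ρ ^ m) =ᶠ[nhds s] gs A := by
      filter_upwards [hcT.eventually (isOpen_Ioo.mem_nhds hs)] with s' hs'
      rw [← hT.slices hA ht hρ h heq hs']
      field_simp
    refine ContinuousAt.congr ?_ h1
    exact (ContinuousAt.comp (f := T) (DD_gs_cont hs) hcT).div_const _
  have dA := ((ms_hasStrictDerivAt hA hgc).hasDerivAt.const_mul (ρ ^ (m + 1)))
  have dD := ms_hasStrictDerivAt (DD_compact ht) (DD_gs_cont (m := m) hs)
  have hpos := DD_gs_pos (m := m) hs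
  have hinv := (dD.to_localInverse hpos.ne').hasDerivAt
  rw [hT.eq s] at hinv
  have hcomp := hinv.comp s dA
  have hval : (gs (DD m t) (T s))⁻¹ * (ρ ^ (m + 1) * gs A s) = ρ := by
    rw [← hT.slices hA ht hρ h heq hs] at hpos ⊢
    have hg : gs A s ≠ 0 := by
      intro h0
      simp [h0] at hpos
    have hρ0 : ρ ≠ 0 := hρ.ne'
    field_simp
    ring
  rw [hval] at hcomp
  refine hcomp.congr_of_eventuallyEq ?_
  filter_upwards [hcT.eventually (dD.eventually_left_inverse hpos.ne')] with s' hs'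
  rw [Function.comp_apply, ← hT.eq, hs']

lemma Transport.affine {A : Set (ℝ × EuclideanSpace ℝ (Fin m))} (hA : IsCompact A) {t ρ : ℝ}
    {T : ℝ → ℝ} (ht : 0 < t) (hρ : 0 < ρ)
    (h : volume.real (DD m t) = ρ ^ (m + 1) * volume.real A)
    (heq : volume.real (A + DD m t) ≤ (1 + ρ) ^ (m + 1) * volume.real A)
    (hT : Transport A t ρ T) : ∃ c, ∀ u ∈ Ioo (-t) t, T (c + u / ρ) = u := by
  have hTm := hT.mono hA ht hρ
  have hρm : 0 < ρ ^ (m + 1) := by positivity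
  have surj : ∀ u ∈ Icc (-t) t, ∃ s, T s = u := by
    intro u hu
    obtain ⟨s, hs⟩ := exists_ms_eq hA (c := ms (DD m t) u / ρ ^ (m + 1))
      (div_nonneg (ms_nonneg _ _) hρm.le) (by
        rw [div_le_iff₀ hρm, mul_comm, ← h]; exact ms_le (DD_compact ht) u)
    refine ⟨s, hT.uniq ht hu ?_⟩
    rw [hs]; field_simp
  have lin : ∀ a b, a < b → T a ∈ Ioo (-t) t → T b ∈ Ioo (-t) t → T b - T a = ρ * (b - a) := by
    intro a b hab ha hb
    have hmem : ∀ x ∈ Icc a b, T x ∈ Ioo (-t) t := fun x hx =>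
      ⟨lt_of_lt_of_le ha.1 (hTm hx.1), lt_of_le_of_lt (hTm hx.2) hb.2⟩
    obtain ⟨x, -, hx⟩ := exists_hasDerivAt_eq_slope T (fun _ => ρ) hab
      (fun x hx => (hT.cont hA ht (hmem x hx)).continuousWithinAt)
      (fun x hx => hT.deriv hA ht hρ h heq (hmem x (Ioo_subset_Icc_self hx)))
    have : b - a ≠ 0 := by linarith
    field_simp at hx
    linarith
  obtain ⟨c, hc⟩ := surj 0 ⟨by linarith, ht.le⟩
  have hcI : T c ∈ Ioo (-t) t := by rw [hc]; exact ⟨by linarith, ht⟩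
  refine ⟨c, fun u hu => ?_⟩
  obtain ⟨s, hs⟩ := surj u (Ioo_subset_Icc_self hu)
  have hsI : T s ∈ Ioo (-t) t := by rwa [hs]
  have : u = ρ * (s - c) := by
    rcases lt_trichotomy s c with hl | hl | hl
    · have := lin s c hl hsI hcI
      rw [hc, hs] at this; linarith
    · subst hl; rw [hc] at hs; simp [← hs]
    · have := lin c s hl hcI hsI
      rw [hc, hs] at this; linarith
  have e : c + u / ρ = s := by rw [this]; field_simp; ring
  rw [e, hs]

lemma integral_fst {A : Set (ℝ × EuclideanSpace ℝ (Fin m))} (hA : IsCompact A) {f : ℝ → ℝ}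
    (hf : Continuous f) : ∫ x in A, f x.1 = ∫ s, gs A s * f s := by
  have hint : IntegrableOn (fun x : ℝ × EuclideanSpace ℝ (Fin m) => f x.1) A :=
    (by fun_prop : Continuous fun x : ℝ × EuclideanSpace ℝ (Fin m) => f x.1).continuousOn.integrableOn_compact hA
  rw [← integral_indicator hA.measurableSet, Measure.volume_eq_prod, integral_prod]
  · congr 1
    ext s
    have : (fun y => A.indicator (fun x : ℝ × EuclideanSpace ℝ (Fin m) => f x.1) (s, y))
        = (Prod.mk s ⁻¹' A).indicator fun _ => f s := by
      ext y; rfl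
    rw [this, integral_indicator (slice_compact hA s).measurableSet, setIntegral_const, smul_eq_mul, gs]
  · exact (integrable_indicator_iff hA.measurableSet).2 hint

/-- Equality case in a fixed direction. -/
theorem prod_equality {A : Set (ℝ × EuclideanSpace ℝ (Fin m))} (hA : IsCompact A) {t ρ : ℝ}
    (ht : 0 < t) (hρ : 0 < ρ)
    (h : volume.real (DD m t) = ρ ^ (m + 1) * volume.real A)
    (heq : volume.real (A + DD m t) ≤ (1 + ρ) ^ (m + 1) * volume.real A) :
    ∃ c, volume (restr A (Ici (c + t / ρ))) = 0 ∧ ∫ x in A, (x.1 - c) = 0 := by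
  have hρm : 0 < ρ ^ m := by positivity
  have hρm1 : 0 < ρ ^ (m + 1) := by positivity
  obtain ⟨T, hT⟩ := exists_transport hA ht hρ h
  obtain ⟨c, hc⟩ := hT.affine hA ht hρ h heq
  refine ⟨c, ?_⟩
  have hD := DD_compact (m := m) ht
  have hall : EqOn (ms (DD m t)) (fun u => ρ ^ (m + 1) * ms A (c + u / ρ)) (Icc (-t) t) := by
    have h1 : EqOn (ms (DD m t)) (fun u => ρ ^ (m + 1) * ms A (c + u / ρ)) (Ioo (-t) t) := by
      intro u hu
      have := hT.eq (c + u / ρ)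
      rwa [hc u hu] at this
    have h2 := h1.closure (ms_continuous hD)
      (continuous_const.mul ((ms_continuous hA).comp (by fun_prop)))
    rwa [closure_Ioo (by linarith)] at h2
  have htop : ms A (c + t / ρ) = volume.real A := by
    have := hall (right_mem_Icc.2 (by linarith))
    rw [DD_ms_top ht, h] at this
    exact (mul_left_cancel₀ hρm1.ne' this).symm
  have hbot : ms A (c - t / ρ) = 0 := by
    have := hall (left_mem_Icc.2 (by linarith))
    rw [DD_ms_bot ht] at this
    rcases mul_eq_zero.1 this.symm with h1 | h1
    · exact absurd h1 hρm1.ne'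
    · rw [← h1]; congr 1; ring
  have hI1 : volume.real (restr A (Ici (c + t / ρ))) = 0 := by
    rw [vol_restr_Ici hA, htop, sub_self]
  refine ⟨?_, ?_⟩
  · rwa [measureReal_eq_zero_iff (restr_compact hA isClosed_Ici).measure_lt_top.ne] at hI1
  · rw [integral_fst hA (f := fun s => s - c) (by fun_prop)]
    let G : ℝ → ℝ := (Ioo (c - t / ρ) (c + t / ρ)).indicator (gs A)
    have hG : gs A =ᵐ[volume] G := by
      rw [vol_restr hA isClosed_Ici] at hI1
      rw [ms_eq hA] at hbot
      rw [setIntegral_eq_zero_iff_of_nonneg_ae (Eventually.of_forall (gs_nonneg A))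
        (gs_integrable hA).integrableOn, EventuallyEq, ae_restrict_iff' (by measurability)] at hI1 hbot
      filter_upwards [hI1, hbot] with s h1 h2
      by_cases hs : s ∈ Ioo (c - t / ρ) (c + t / ρ)
      · simp only [G]; rw [indicator_of_mem hs]
      · simp only [G]; rw [indicator_of_notMem hs]
        simp only [mem_Ioo, not_and_or, not_lt] at hs
        rcases hs with hs | hs
        · exact h2 hs
        · exact h1 hs
    have hGs : ∀ s, G (2 * c - s) = G s := by
      intro s
      by_cases hs : s ∈ Ioo (c - t / ρ) (c + t / ρ)
      · have hs' : 2 * c - s ∈ Ioo (c - t / ρ) (c + t / ρ) :=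
          ⟨by linarith [hs.2], by linarith [hs.1]⟩
        simp only [G]
        rw [indicator_of_mem hs, indicator_of_mem hs']
        have hu : ρ * (s - c) ∈ Ioo (-t) t := by
          have e : t = ρ * (t / ρ) := by field_simp
          rw [e]
          constructor
          · rw [← mul_neg]; gcongr; linarith [hs.1]
          · gcongr; linarith [hs.2]
        have hu' : -(ρ * (s - c)) ∈ Ioo (-t) t := ⟨by linarith [hu.2], by linarith [hu.1]⟩
        have e1 : c + ρ * (s - c) / ρ = s := by field_simp; ring
        have e2 : c + -(ρ * (s - c)) / ρ = 2 * c - s := by field_simp; ring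
        have k1 := hc _ hu
        have k2 := hc _ hu'
        rw [e1] at k1
        rw [e2] at k2
        have l1 := hT.slices hA ht hρ h heq (s := s) (by rwa [k1])
        have l2 := hT.slices hA ht hρ h heq (s := 2 * c - s) (by rwa [k2])
        rw [k1] at l1
        rw [k2, DD_gs_even, ← l1] at l2
        exact mul_right_cancel₀ hρm.ne' l2
      · have hs' : 2 * c - s ∉ Ioo (c - t / ρ) (c + t / ρ) := fun hh =>
          hs ⟨by linarith [hh.2], by linarith [hh.1]⟩
        simp only [G]
        rw [indicator_of_notMem hs, indicator_of_notMem hs']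
    have e0 : ∫ s, gs A s * (s - c) = ∫ s, G s * (s - c) :=
      integral_congr_ae (hG.mono fun s hs => by simp only [hs])
    have e1 := integral_sub_left_eq_self (fun s => G s * (s - c)) volume (2 * c)
    have e2 : ∫ s, G (2 * c - s) * (2 * c - s - c) = - ∫ s, G s * (s - c) := by
      rw [← integral_neg]
      congr 1
      ext s
      rw [hGs]; ring
    rw [e0]
    linarith

end equality


lemma vol_cball (m : ℕ) (x : EuclideanSpace ℝ (Fin (m+1))) {s : ℝ} (hs : 0 ≤ s) :
    volume.real (closedBall x s) = s ^ (m + 1) *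
      volume.real (ball (0 : EuclideanSpace ℝ (Fin (m+1))) 1) := by
  rw [Measure.addHaar_real_closedBall _ _ hs, finrank_euclideanSpace_fin]

lemma unit_pos (m : ℕ) : 0 < volume.real (ball (0 : EuclideanSpace ℝ (Fin (m+1))) 1) :=
  ENNReal.toReal_pos (measure_ball_pos _ _ one_pos).ne' measure_ball_lt_top.ne

lemma half_space_null {m : ℕ} {K : Set (EuclideanSpace ℝ (Fin (m+1)))} (hK : IsCompact K)
    {R t : ℝ} (hR : 0 < R) (ht : 0 < t)
    (hvol : volume.real K = volume.real (closedBall (0 : EuclideanSpace ℝ (Fin (m+1))) R))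
    (hsum : volume.real (K + closedBall (0 : EuclideanSpace ℝ (Fin (m+1))) t) ≤
      volume.real (closedBall (0 : EuclideanSpace ℝ (Fin (m+1))) (R + t)))
    (ν : EuclideanSpace ℝ (Fin (m+1))) (hν : ‖ν‖ = 1) :
    volume (K ∩ {x | inner ℝ ν ((volume.real K)⁻¹ • ∫ x in K, x) + R ≤ inner ℝ ν x}) = 0 := by
  obtain ⟨φ, hφ, hφ1, hφ2⟩ := exists_split m ν hν
  have hω := unit_pos m
  rw [vol_cball m _ hR.le] at hvol
  rw [vol_cball m _ (by linarith)] at hsum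
  have hKpos : 0 < volume.real K := by rw [hvol]; positivity
  have hDD : φ '' (closedBall 0 t) = DD m t := by
    ext y
    constructor
    · rintro ⟨x, hx, rfl⟩
      rw [mem_closedBall_zero_iff] at hx
      show (φ x).1 ^ 2 + ‖(φ x).2‖ ^ 2 ≤ t ^ 2
      rw [← hφ2]
      exact pow_le_pow_left₀ (norm_nonneg _) hx 2
    · intro hy
      refine ⟨φ.symm y, ?_, by simp⟩
      rw [mem_closedBall_zero_iff]
      have h1 : y.1 ^ 2 + ‖y.2‖ ^ 2 ≤ t ^ 2 := hy
      have h2 := hφ2 (φ.symm y)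
      rw [φ.apply_symm_apply] at h2
      rw [← h2] at h1
      exact (pow_le_pow_iff_left₀ (norm_nonneg _) ht.le two_ne_zero).1 h1
  have hA : IsCompact (φ '' K) := hK.image φ.continuous
  have hvr : ∀ S, volume.real (φ '' S) = volume.real S := fun S => by
    rw [Measure.real, vol_image_split hφ S, Measure.real]
  have h1 : volume.real (DD m t) = (t / R) ^ (m + 1) * volume.real (φ '' K) := by
    rw [← hDD, hvr, hvr, vol_cball m _ ht.le, hvol, div_pow]
    field_simp
  have h2 : volume.real (φ '' K + DD m t) ≤ (1 + t / R) ^ (m + 1) * volume.real (φ '' K) := by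
    rw [← hDD, ← image_add, hvr, hvr, hvol]
    refine hsum.trans (le_of_eq ?_)
    rw [← mul_assoc, ← mul_pow]
    congr 2
    field_simp
  obtain ⟨c, hc1, hc2⟩ := prod_equality hA ht (by positivity) h1 h2
  have htR : t / (t / R) = R := by field_simp
  rw [htR] at hc1
  have hint : IntegrableOn (fun x : EuclideanSpace ℝ (Fin (m+1)) => x) K volume :=
    continuous_id.continuousOn.integrableOn_compact hK
  have hcc : inner ℝ ν ((volume.real K)⁻¹ • ∫ x in K, x) = c := by
    rw [hφ.setIntegral_image_emb φ.toHomeomorph.measurableEmbedding] at hc2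
    simp only [hφ1] at hc2
    have i1 : IntegrableOn (fun x : EuclideanSpace ℝ (Fin (m+1)) => inner ℝ ν x) K volume :=
      Continuous.continuousOn (by fun_prop) |>.integrableOn_compact hK
    have i2 : IntegrableOn (fun x : EuclideanSpace ℝ (Fin (m+1)) => c) K volume :=
      continuous_const.continuousOn.integrableOn_compact hK
    rw [integral_sub i1 i2,
      integral_inner hint, setIntegral_const, smul_eq_mul] at hc2
    rw [inner_smul_right]
    field_simp
    linarith
  rw [hcc, ← vol_image_split hφ]
  refine measure_mono_null ?_ hc1
  rintro _ ⟨x, ⟨hx, hx2⟩, rfl⟩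
  refine ⟨⟨x, hx, rfl⟩, ?_⟩
  show c + R ≤ (φ x).1
  rw [hφ1]; exact hx2

theorem ball_rigidity {m : ℕ} {K : Set (EuclideanSpace ℝ (Fin (m+1)))} (hK : IsCompact K)
    {R t : ℝ} (hR : 0 < R) (ht : 0 < t)
    (hvol : volume.real K = volume.real (closedBall (0 : EuclideanSpace ℝ (Fin (m+1))) R))
    (hsum : volume.real (K + closedBall (0 : EuclideanSpace ℝ (Fin (m+1))) t) ≤
      volume.real (closedBall (0 : EuclideanSpace ℝ (Fin (m+1))) (R + t))) :
    ∃ c, volume (K \ closedBall c R) = 0 := by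
  refine ⟨(volume.real K)⁻¹ • ∫ x in K, x, ?_⟩
  have key := half_space_null hK hR ht hvol hsum
  set c := (volume.real K)⁻¹ • ∫ x in K, x with hc
  obtain ⟨D, hDc, hDd⟩ := TopologicalSpace.exists_countable_dense
    (sphere (0 : EuclideanSpace ℝ (Fin (m+1))) 1)
  have hn : volume (⋃ ν ∈ D, (K ∩ {x | inner ℝ (ν : EuclideanSpace ℝ (Fin (m+1))) c + R ≤
      inner ℝ (ν : EuclideanSpace ℝ (Fin (m+1))) x})) = 0 :=
    (measure_biUnion_null_iff hDc).2 fun ν _ => key ν (by simp)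
  refine measure_mono_null ?_ hn
  rintro x ⟨hxK, hx⟩
  rw [mem_closedBall, not_le, dist_eq_norm] at hx
  have hpos : 0 < ‖x - c‖ := hR.trans hx
  let ν₀ : sphere (0 : EuclideanSpace ℝ (Fin (m+1))) 1 := ⟨‖x - c‖⁻¹ • (x - c), by
    rw [mem_sphere_zero_iff_norm, norm_smul, norm_inv, norm_norm, inv_mul_cancel₀ hpos.ne']⟩
  have hO : IsOpen {ν : sphere (0 : EuclideanSpace ℝ (Fin (m+1))) 1 |
      R < inner ℝ (ν : EuclideanSpace ℝ (Fin (m+1))) (x - c)} :=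
    isOpen_lt (by fun_prop) (by fun_prop)
  obtain ⟨ν, hν, hνD⟩ := hDd.exists_mem_open hO ⟨ν₀, by
    show R < inner ℝ (‖x - c‖⁻¹ • (x - c)) (x - c)
    rw [real_inner_smul_left, real_inner_self_eq_norm_sq]
    field_simp
    exact hx⟩
  have h3 : R < inner ℝ (ν : EuclideanSpace ℝ (Fin (m+1))) (x - c) := hνD
  rw [inner_sub_right] at h3
  simp only [mem_iUnion]
  exact ⟨ν, hν, hxK, (by linarith : inner ℝ (ν : EuclideanSpace ℝ (Fin (m+1))) c + R ≤ inner ℝ (ν : EuclideanSpace ℝ (Fin (m+1))) x)⟩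


lemma bm_ball {m : ℕ} {K : Set (EuclideanSpace ℝ (Fin (m+1)))} (hK : IsCompact K)
    (hne : K.Nonempty) {t S c : ℝ} (ht : 0 ≤ t) (hS : 0 ≤ S) (hc : 0 ≤ c)
    (h : volume (K + closedBall (0 : EuclideanSpace ℝ (Fin (m+1))) t) ≤
      volume (closedBall (0 : EuclideanSpace ℝ (Fin (m+1))) S))
    (hcK : c ^ (m + 1) * volume.real (ball (0 : EuclideanSpace ℝ (Fin (m+1))) 1)
      ≤ volume.real K) : c + t ≤ S := by
  obtain ⟨w, hw, hw2⟩ := exists_root (unit_pos m) (Nat.succ_ne_zero m)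
  have hw3 : w ^ (m + 1) = volume.real (ball (0 : EuclideanSpace ℝ (Fin (m+1))) 1) := hw2
  have h1 := bm_all (m + 1) K (closedBall 0 t) hK (isCompact_closedBall _ _) hne
    ⟨0, by simpa using ht⟩ (c * w) (t * w) (by positivity) (by positivity)
    (by rw [mul_pow, hw3]; exact hcK) (by rw [vol_cball m _ ht, mul_pow, hw3])
  have h2 : volume.real (K + closedBall (0 : EuclideanSpace ℝ (Fin (m+1))) t) ≤
      volume.real (closedBall (0 : EuclideanSpace ℝ (Fin (m+1))) S) :=
    ENNReal.toReal_mono measure_closedBall_lt_top.ne h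
  rw [vol_cball m _ hS, ← hw3, ← mul_pow] at h2
  rw [← add_mul] at h1
  have h3 := (pow_le_pow_iff_left₀ (by positivity) (by positivity) (Nat.succ_ne_zero m)).1
    (h1.trans h2)
  exact le_of_mul_le_mul_right h3 hw

lemma exists_radius {m : ℕ} (K : Set (EuclideanSpace ℝ (Fin (m+1)))) :
    ∃ c : ℝ, 0 ≤ c ∧ volume.real K =
      c ^ (m + 1) * volume.real (ball (0 : EuclideanSpace ℝ (Fin (m+1))) 1) := by
  have hω := unit_pos m
  rcases (measureReal_nonneg (μ := volume) (s := K)).eq_or_lt with h | h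
  · exact ⟨0, le_rfl, by rw [← h]; simp⟩
  · obtain ⟨w, hw, hw2⟩ := exists_root (div_pos h hω) (Nat.succ_ne_zero m)
    refine ⟨w, hw.le, ?_⟩
    rw [show w ^ (m+1) = _ from hw2]
    field_simp

lemma minkSum_open (n : ℕ) (r : ℝ) (A : Set (EuclideanSpace ℝ (Fin n))) :
    IsOpen (minkSum n r A) := isOpen_biUnion fun _ _ => isOpen_ball

lemma mem_minkSum {n : ℕ} {r : ℝ} {A : Set (EuclideanSpace ℝ (Fin n))}
    {y : EuclideanSpace ℝ (Fin n)} : y ∈ minkSum n r A ↔ ∃ x ∈ A, dist y x < r := by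
  simp [minkSum]

lemma mem_P_of_cross {n : ℕ} {r : ℝ} {F : Set (EuclideanSpace ℝ (Fin n))}
    {x a b : EuclideanSpace ℝ (Fin n)} (ha : a ∈ ball x r) (haF : a ∈ F)
    (hb : b ∈ ball x r) (hbF : b ∉ F) : x ∈ minkSum n r (frontier F) := by
  have hc : IsPreconnected (ball x r) := (convex_ball x r).isPreconnected
  by_contra hcon
  have hno : ∀ z ∈ ball x r, z ∉ frontier F := fun z hz hzF =>
    hcon (mem_minkSum.2 ⟨z, hzF, by rw [dist_comm]; exact hz⟩)
  have hcov : ball x r ⊆ interior F ∪ (closure F)ᶜ := by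
    intro z hz
    by_cases h1 : z ∈ interior F
    · exact Or.inl h1
    · exact Or.inr fun h2 => hno z hz ⟨h2, h1⟩
  have haI : a ∈ interior F := (hcov ha).resolve_right fun h => h (subset_closure haF)
  have hbI : b ∈ (closure F)ᶜ := (hcov hb).resolve_left fun h => hbF (interior_subset h)
  obtain ⟨z, -, h1, h2⟩ := hc _ _ isOpen_interior isClosed_closure.isOpen_compl hcov
    ⟨a, ha, haI⟩ ⟨b, hb, hbI⟩
  exact h2 (subset_closure (interior_subset h1))

lemma core_ball {n : ℕ} {r : ℝ} (hr : 0 < r) {F : Set (EuclideanSpace ℝ (Fin n))}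
    {x : EuclideanSpace ℝ (Fin n)} (hx : x ∈ F \ minkSum n r (frontier F)) : ball x r ⊆ F := by
  intro y hy
  by_contra hyF
  exact hx.2 (mem_P_of_cross (mem_ball_self hr) hx.1 hy hyF)

lemma core_eq {n : ℕ} {r : ℝ} (hr : 0 < r) (F : Set (EuclideanSpace ℝ (Fin n))) :
    F \ minkSum n r (frontier F) = minkSum n r F \ minkSum n r (frontier F) := by
  ext y
  constructor
  · rintro ⟨h1, h2⟩
    exact ⟨mem_minkSum.2 ⟨y, h1, by simpa using hr⟩, h2⟩
  · rintro ⟨h1, h2⟩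
    refine ⟨?_, h2⟩
    by_contra hy
    obtain ⟨x, hx, hxy⟩ := mem_minkSum.1 h1
    exact h2 (mem_P_of_cross (a := x) (b := y) (by rw [mem_ball, dist_comm]; exact hxy) hx
      (mem_ball_self hr) hy)

lemma P_sub_U {n : ℕ} {r : ℝ} (F : Set (EuclideanSpace ℝ (Fin n))) :
    minkSum n r (frontier F) ⊆ minkSum n r F := by
  intro y hy
  obtain ⟨z, hz, hzy⟩ := mem_minkSum.1 hy
  obtain ⟨x, hx, hzx⟩ := Metric.mem_closure_iff.1 (frontier_subset_closure hz) (r - dist y z)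
    (by linarith)
  exact mem_minkSum.2 ⟨x, hx, by linarith [dist_triangle y z x]⟩

lemma vol_U {n : ℕ} {r : ℝ} (hr : 0 < r) (F : Set (EuclideanSpace ℝ (Fin n))) :
    volume (minkSum n r F) = volume (minkSum n r (frontier F)) +
      volume (F \ minkSum n r (frontier F)) := by
  rw [core_eq hr, ← measure_inter_add_sdiff (minkSum n r F)
    (minkSum_open n r (frontier F)).measurableSet, inter_eq_self_of_subset_right (P_sub_U F)]

lemma vol_cb_ball {m : ℕ} (x : EuclideanSpace ℝ (Fin (m+1))) (s : ℝ) :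
    volume (closedBall x s) = volume (ball x s) :=
  Measure.addHaar_closedBall_eq_addHaar_ball _ _ _

lemma vol_core {m : ℕ} {r R : ℝ} (hr : 0 < r) (hR : 0 < R)
    (F : Set (EuclideanSpace ℝ (Fin (m+1))))
    (hF : volume F = volume (ball (0 : EuclideanSpace ℝ (Fin (m+1))) R)) :
    volume (F \ minkSum (m+1) r (frontier F)) ≤
      volume (ball (0 : EuclideanSpace ℝ (Fin (m+1))) (R - r)) := by
  by_contra hcon
  rw [not_le] at hcon
  have hmeas : MeasurableSet (F \ minkSum (m+1) r (frontier F)) := by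
    rw [core_eq hr]
    exact (minkSum_open _ _ _).measurableSet.diff (minkSum_open _ _ _).measurableSet
  obtain ⟨C, hCsub, hC, hlt⟩ := hmeas.exists_lt_isCompact hcon
  have hne : C.Nonempty := by
    rw [nonempty_iff_ne_empty]
    rintro rfl
    simp at hlt
  obtain ⟨c, hc0, hc⟩ := exists_radius C
  have hle : ∀ t, 0 ≤ t → t < r → c + t ≤ R := by
    intro t ht htr
    refine bm_ball hC hne ht hR.le hc0 ?_ hc.ge
    rw [vol_cb_ball, ← hF]
    apply measure_mono
    rintro _ ⟨x, hx, v, hv, rfl⟩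
    apply core_ball hr (hCsub hx)
    rw [mem_closedBall_zero_iff] at hv
    rw [mem_ball, dist_eq_norm]
    show ‖x + v - x‖ < r
    rw [add_sub_cancel_left]
    linarith
  have hcR : c ≤ R - r := by
    by_contra h
    rw [not_le] at h
    obtain ⟨t, h1, h2⟩ := exists_between (show max 0 (R - c) < r by
      apply max_lt hr; linarith)
    have := hle t ((le_max_left _ _).trans h1.le) h2
    have := (le_max_right 0 (R - c)).trans_lt h1
    linarith
  rw [← vol_cb_ball] at hlt
  have h3 := (ENNReal.toReal_lt_toReal measure_closedBall_lt_top.ne hC.measure_lt_top.ne).2 hlt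
  have h4 : volume.real (closedBall (0 : EuclideanSpace ℝ (Fin (m+1))) (R - r)) < volume.real C := h3
  rw [hc, vol_cball m _ (hc0.trans hcR)] at h4
  have := lt_of_mul_lt_mul_right h4 (unit_pos m).le
  exact absurd (pow_le_pow_left₀ hc0 hcR (m+1)) (not_le.2 this)

lemma density_ae {m : ℕ} {E : Set (EuclideanSpace ℝ (Fin (m+1)))} (hE : MeasurableSet E) :
    densityOnePoints (m+1) E =ᵐ[volume] E := by
  have hb : ∀ (x : EuclideanSpace ℝ (Fin (m+1))) (ρ : ℝ),
      (ball x ρ : Set _) =ᵐ[volume] closedBall x ρ := fun x ρ =>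
    ae_eq_of_subset_of_measure_ge ball_subset_closedBall (vol_cb_ball x ρ).le
      measurableSet_ball.nullMeasurableSet measure_closedBall_lt_top.ne
  filter_upwards [Besicovitch.ae_tendsto_measure_inter_div_of_measurableSet
    (volume : Measure (EuclideanSpace ℝ (Fin (m+1)))) hE] with x hx
  have hx' : Tendsto (fun ρ : ℝ => volume (E ∩ ball x ρ) / volume (ball x ρ))
        (nhdsWithin 0 (Ioi 0)) (nhds (E.indicator 1 x)) := by
    refine hx.congr fun ρ => ?_
    rw [measure_congr (hb x ρ), measure_congr ((ae_eq_refl E).inter (hb x ρ))]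
  have : x ∈ densityOnePoints (m+1) E ↔ x ∈ E := by
    constructor
    · intro h
      by_contra hxE
      rw [indicator_of_notMem hxE] at hx'
      exact zero_ne_one (tendsto_nhds_unique hx' h)
    · intro h
      rw [indicator_of_mem h] at hx'
      exact hx'
  exact propext this

lemma density_of_mem {m : ℕ} {E : Set (EuclideanSpace ℝ (Fin (m+1)))} (hE : IsOpen E) :
    E ⊆ densityOnePoints (m+1) E := by
  intro x hx
  obtain ⟨e, he, hsub⟩ := Metric.isOpen_iff.1 hE x hx
  refine Tendsto.congr' ?_ tendsto_const_nhds
  filter_upwards [Ioo_mem_nhdsGT he] with ρ hρ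
  rw [inter_eq_self_of_subset_right ((ball_subset_ball hρ.2.le).trans hsub),
    ENNReal.div_self (measure_ball_pos _ _ hρ.1).ne' measure_ball_lt_top.ne]

lemma density_sub {m : ℕ} {E : Set (EuclideanSpace ℝ (Fin (m+1)))} :
    densityOnePoints (m+1) E ⊆ closure E := by
  intro x hx
  by_contra hxE
  obtain ⟨e, he, hsub⟩ := Metric.isOpen_iff.1 isClosed_closure.isOpen_compl x hxE
  refine zero_ne_one (tendsto_nhds_unique (Tendsto.congr' ?_ tendsto_const_nhds) hx)
  filter_upwards [Ioo_mem_nhdsGT he] with ρ hρ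
  have : E ∩ ball x ρ = ∅ := by
    rw [eq_empty_iff_forall_notMem]
    rintro y ⟨h1, h2⟩
    exact hsub (ball_subset_ball hρ.2.le h2) (subset_closure h1)
  simp [this]

lemma frontier_ball_density {m : ℕ} {R : ℝ} (hR : 0 < R) :
    frontier (densityOnePoints (m+1) (ball 0 R)) ⊆ sphere 0 R := by
  rintro x ⟨h1, h2⟩
  have h3 : x ∈ closedBall (0 : EuclideanSpace ℝ (Fin (m+1))) R := by
    rw [← closure_ball _ hR.ne']
    exact closure_minimal density_sub isClosed_closure h1
  have h4 : x ∉ ball (0 : EuclideanSpace ℝ (Fin (m+1))) R := fun h =>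
    h2 (interior_maximal (density_of_mem isOpen_ball) isOpen_ball h)
  rw [mem_ball, not_lt] at h4
  exact le_antisymm h3 h4

lemma ball_bound {m : ℕ} {r R : ℝ} (hr : 0 < r) (hR : 0 < R) :
    volume (minkSum (m+1) r (frontier (densityOnePoints (m+1) (ball 0 R)))) +
      volume (ball (0 : EuclideanSpace ℝ (Fin (m+1))) (R - r)) ≤
      volume (ball (0 : EuclideanSpace ℝ (Fin (m+1))) (R + r)) := by
  rw [← measure_union _ measurableSet_ball]
  · apply measure_mono
    apply union_subset
    · intro y hy
      obtain ⟨z, hz, hyz⟩ := mem_minkSum.1 hy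
      have := mem_sphere.1 (frontier_ball_density hR hz)
      rw [mem_ball]
      linarith [dist_triangle y z 0]
    · exact ball_subset_ball (by linarith)
  · rw [Set.disjoint_left]
    intro y hy hy2
    obtain ⟨z, hz, hyz⟩ := mem_minkSum.1 hy
    have := mem_sphere.1 (frontier_ball_density hR hz)
    rw [mem_ball] at hy2
    have := dist_triangle z y 0
    rw [dist_comm] at hyz
    linarith

lemma bounded_of_vol {m : ℕ} {r : ℝ} (hr : 0 < r) {F : Set (EuclideanSpace ℝ (Fin (m+1)))}
    (h : volume (minkSum (m+1) r F) ≠ ∞) : IsBounded F := by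
  have h0 : Tendsto (fun k : ℕ => volume (minkSum (m+1) r F \ ball 0 k)) atTop
      (nhds (volume (⋂ k : ℕ, minkSum (m+1) r F \ ball 0 k))) := by
    apply tendsto_measure_iInter_atTop
    · intro k
      exact ((minkSum_open _ _ _).measurableSet.diff measurableSet_ball).nullMeasurableSet
    · intro j k hjk
      exact sdiff_subset_sdiff_right (ball_subset_ball (by exact_mod_cast hjk))
    · exact ⟨0, measure_ne_top_of_subset sdiff_subset h⟩
  have he : (⋂ k : ℕ, minkSum (m+1) r F \ ball 0 k) = ∅ := by
    rw [eq_empty_iff_forall_notMem]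
    intro x hx
    obtain ⟨k, hk⟩ := exists_nat_gt ‖x‖
    exact (mem_iInter.1 hx k).2 (by simpa using hk)
  rw [he, measure_empty] at h0
  have hp : 0 < volume (ball (0 : EuclideanSpace ℝ (Fin (m+1))) r) := measure_ball_pos _ _ hr
  obtain ⟨k, hk⟩ := (h0.eventually (gt_mem_nhds hp)).exists
  refine (isBounded_ball (x := (0 : EuclideanSpace ℝ (Fin (m+1)))) (r := k + r)).subset ?_
  intro x hx
  by_contra hxk
  rw [mem_ball, not_lt] at hxk
  refine absurd hk (not_lt.2 ?_)
  rw [← Measure.addHaar_ball_center volume x r]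
  apply measure_mono
  intro y hy
  rw [mem_ball] at hy
  refine ⟨mem_minkSum.2 ⟨x, hx, hy⟩, ?_⟩
  rw [mem_ball, not_lt]
  rw [dist_comm] at hy
  linarith [dist_triangle x y 0]

theorem main_succ (m : ℕ) (r R : ℝ) (hr : 0 < r)
    (hR : 0 < R) (E : Set (EuclideanSpace ℝ (Fin (m+1)))) (hE : MeasurableSet E)
    (hvol : volume E = volume (ball (0 : EuclideanSpace ℝ (Fin (m+1))) R))
    (heq : perR (m+1) r E = perR (m+1) r (ball (0 : EuclideanSpace ℝ (Fin (m+1))) R)) :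
    ∃ x : EuclideanSpace ℝ (Fin (m+1)), volume (symmDiff E (ball x R)) = 0 := by
  have hFE := density_ae hE
  have hper : volume (minkSum (m+1) r (frontier (densityOnePoints (m+1) E))) =
      volume (minkSum (m+1) r (frontier (densityOnePoints (m+1)
        (ball (0 : EuclideanSpace ℝ (Fin (m+1))) R)))) := by
    have h0 : ENNReal.ofReal (2 * r) ≠ 0 := by
      rw [Ne, ENNReal.ofReal_eq_zero]; linarith
    have := congrArg (fun z => z * ENNReal.ofReal (2 * r)) heq
    simpa only [perR, ENNReal.div_mul_cancel h0 ENNReal.ofReal_ne_top] using this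
  set F := densityOnePoints (m+1) E with hFdef
  have hF : volume F = volume (ball (0 : EuclideanSpace ℝ (Fin (m+1))) R) := by
    rw [measure_congr hFE, hvol]
  have hU : volume (minkSum (m+1) r F) ≤
      volume (closedBall (0 : EuclideanSpace ℝ (Fin (m+1))) (R + r)) := by
    rw [vol_cb_ball, vol_U hr, hper]
    exact (add_le_add le_rfl (vol_core hr hR F hF)).trans (ball_bound hr hR)
  have hbd : IsBounded F := bounded_of_vol hr (hU.trans_lt measure_closedBall_lt_top).ne
  have hK : IsCompact (closure F) := hbd.isCompact_closure
  have hFne : F.Nonempty := by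
    rw [nonempty_iff_ne_empty]
    intro h
    rw [h, measure_empty] at hF
    exact (measure_ball_pos volume (0 : EuclideanSpace ℝ (Fin (m+1))) hR).ne hF
  have hKne : (closure F).Nonempty := hFne.closure
  have hsub : ∀ t, t < r → ∀ k ∈ closure F, ∀ v : EuclideanSpace ℝ (Fin (m+1)), ‖v‖ ≤ t →
      k + v ∈ minkSum (m+1) r F := by
    intro t ht k hk v hv
    obtain ⟨x, hx, hkx⟩ := Metric.mem_closure_iff.1 hk (r - t) (by linarith)
    refine mem_minkSum.2 ⟨x, hx, ?_⟩
    have h1 := dist_triangle (k + v) k x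
    have h2 : dist (k + v) k = ‖v‖ := by rw [dist_eq_norm, add_sub_cancel_left]
    linarith
  have hKvol : volume.real (closure F) =
      volume.real (closedBall (0 : EuclideanSpace ℝ (Fin (m+1))) R) := by
    apply le_antisymm
    · obtain ⟨c, hc0, hc⟩ := exists_radius (closure F)
      have hcR : c ≤ R := by
        by_contra h
        rw [not_le] at h
        obtain ⟨t, h1, h2⟩ := exists_between (show max 0 (R + r - c) < r by
          apply max_lt hr; linarith)
        have h3 := (le_max_right 0 (R + r - c)).trans_lt h1
        have h4 := (le_max_left 0 (R + r - c)).trans h1.le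
        have h5 : c + t ≤ R + r := by
          refine bm_ball hK hKne h4 (by linarith) hc0 (le_trans (measure_mono ?_) hU) hc.ge
          rintro _ ⟨k, hk, v, hv, rfl⟩
          exact hsub t h2 k hk v (by simpa using hv)
        linarith
      rw [hc, vol_cball m _ hR.le]
      exact mul_le_mul_of_nonneg_right (pow_le_pow_left₀ hc0 hcR _) (unit_pos m).le
    · apply ENNReal.toReal_mono hK.measure_lt_top.ne
      rw [vol_cb_ball, ← hF]
      exact measure_mono subset_closure
  have hr2 : 0 < r / 2 := by linarith
  have hK2 : IsCompact (closure F + closedBall (0 : EuclideanSpace ℝ (Fin (m+1))) (r / 2)) :=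
    hK.add (isCompact_closedBall _ _)
  have hsum : volume.real (closure F + closedBall (0 : EuclideanSpace ℝ (Fin (m+1))) (r / 2)) ≤
      volume.real (closedBall (0 : EuclideanSpace ℝ (Fin (m+1))) (R + r / 2)) := by
    obtain ⟨c, hc0, hc⟩ := exists_radius
      (closure F + closedBall (0 : EuclideanSpace ℝ (Fin (m+1))) (r / 2))
    have hcR : c ≤ R + r / 2 := by
      by_contra h
      rw [not_le] at h
      obtain ⟨t, h1, h2⟩ := exists_between (show max 0 (R + r - c) < r / 2 by
        apply max_lt hr2; linarith)
      have h3 := (le_max_right 0 (R + r - c)).trans_lt h1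
      have h4 := (le_max_left 0 (R + r - c)).trans h1.le
      have h5 : c + t ≤ R + r := by
        refine bm_ball hK2 (hKne.add ⟨0, by simpa using hr2.le⟩) h4 (by linarith) hc0
          (le_trans (measure_mono ?_) hU) hc.ge
        rintro _ ⟨_, ⟨k, hk, u, hu, rfl⟩, v, hv, rfl⟩
        rw [mem_closedBall_zero_iff] at hu hv
        show k + u + v ∈ _
        rw [add_assoc]
        exact hsub (r / 2 + t) (by linarith) k hk (u + v) ((norm_add_le _ _).trans (by linarith))
      linarith
    rw [hc, vol_cball m _ (by linarith)]
    exact mul_le_mul_of_nonneg_right (pow_le_pow_left₀ hc0 hcR _) (unit_pos m).le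
  obtain ⟨c, hc⟩ := ball_rigidity hK hR hr2 hKvol hsum
  refine ⟨c, ?_⟩
  rw [measure_symmDiff_eq_zero_iff]
  have hb : (ball c R : Set _) =ᵐ[volume] closedBall c R :=
    ae_eq_of_subset_of_measure_ge ball_subset_closedBall (vol_cb_ball c R).le
      measurableSet_ball.nullMeasurableSet measure_closedBall_lt_top.ne
  refine EventuallyEq.trans ?_ hb.symm
  refine ae_eq_of_ae_subset_of_measure_ge ?_ ?_ hE.nullMeasurableSet measure_closedBall_lt_top.ne
  · refine hFE.symm.le.trans ((ae_le_set.2 (measure_mono_null ?_ hc)))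
    exact sdiff_subset_sdiff_left subset_closure
  · rw [hvol, vol_cb_ball, Measure.addHaar_ball_center]

/-- Balls are the unique minimizers in the isoperimetric inequality
for the Minkowski perimeter. -/
theorem minkowski_isoperimetric_equality (n : ℕ) (hn : 1 ≤ n) (r R : ℝ) (hr : 0 < r)
    (hR : 0 < R) (E : Set (EuclideanSpace ℝ (Fin n))) (hE : MeasurableSet E)
    (hvol : volume E = volume (ball (0 : EuclideanSpace ℝ (Fin n)) R))
    (heq : perR n r E = perR n r (ball (0 : EuclideanSpace ℝ (Fin n)) R)) :
    ∃ x : EuclideanSpace ℝ (Fin n), volume (symmDiff E (ball x R)) = 0 := by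
  obtain ⟨m, rfl⟩ := Nat.exists_eq_add_of_le' hn
  exact main_succ m r R hr hR E hE hvol heq
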